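/- arXiv:2507.17854 — 2 statements merged into one kernel-verified Lean document; each statement's English description precedes it below -/
import Mathlib

section
/- Let A = (a_{ij})_{i,j∈I} be a symmetric real matrix with a_{ii} ≤ 0 for all i, let J = {j ∈ I : a_{jj} = 0}, and assume a_{ij} = 0 if and only if both i, j ∈ J. Then the Borcherds algebra 𝔤(A) decomposes as a vector space direct sum 𝔤(A) = 𝔲⁻ ⊕ (𝔤_J + 𝔥) ⊕ 𝔲⁺, where 𝔲⁺ and 𝔲⁻ are free Lie subalgebras generated respectively by the sets U⁺ = {ad(e_{j₁})^{ℓ₁}⋯ad(e_{jₙ})^{ℓₙ} e_i : n ≥ 0, j₁ < ⋯ < jₙ ∈ J, ℓ_k > 0, i ∈ I∖J} and U⁻ = {ad(f_{j₁})^{ℓ₁}⋯ad(f_{jₙ})^{ℓₙ} f_i : n ≥ 0, j₁ < ⋯ < jₙ ∈ J, ℓ_k > 0, i ∈ I∖J}, and 𝔤_J is the Borcherds algebra of the submatrix (a_{ij})_{i,j∈J}. -/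
open scoped Classical
open FreeLieAlgebra

/-- Generators `e i`, `f i`, `h i` of a Borcherds algebra. -/
inductive BGen (I : Type*) : Type _
  | E : I → BGen I
  | F : I → BGen I
  | H : I → BGen I

/-- The defining relations of the Borcherds algebra of a symmetrized Borcherds
Cartan matrix `A` inside the free Lie algebra on the generators. -/
noncomputable def borcherdsRels {I : Type*} (A : I → I → ℝ) :
    Set (FreeLieAlgebra ℂ (BGen I)) :=
  { x | ∃ i j : I,
      x = ⁅of ℂ (BGen.H i), of ℂ (BGen.H j)⁆ ∨
      x = ⁅of ℂ (BGen.H i), of ℂ (BGen.E j)⁆ - (A i j : ℂ) • of ℂ (BGen.E j) ∨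
      x = ⁅of ℂ (BGen.H i), of ℂ (BGen.F j)⁆ + (A i j : ℂ) • of ℂ (BGen.F j) ∨
      x = ⁅of ℂ (BGen.E i), of ℂ (BGen.F j)⁆ - (if i = j then of ℂ (BGen.H i) else 0) ∨
      (∃ n : ℕ, i ≠ j ∧ 0 < A i i ∧ (n : ℝ) = 1 - 2 * A i j / A i i ∧
        (x = ((LieAlgebra.ad ℂ (FreeLieAlgebra ℂ (BGen I)) (of ℂ (BGen.E i))) ^ n)
              (of ℂ (BGen.E j)) ∨
         x = ((LieAlgebra.ad ℂ (FreeLieAlgebra ℂ (BGen I)) (of ℂ (BGen.F i))) ^ n)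
              (of ℂ (BGen.F j)))) ∨
      (A i j = 0 ∧
        (x = ⁅of ℂ (BGen.E i), of ℂ (BGen.E j)⁆ ∨
         x = ⁅of ℂ (BGen.F i), of ℂ (BGen.F j)⁆)) }

/-- The ideal of relations. -/
noncomputable def borcherdsIdeal {I : Type*} (A : I → I → ℝ) :
    LieIdeal ℂ (FreeLieAlgebra ℂ (BGen I)) :=
  LieSubmodule.lieSpan ℂ (FreeLieAlgebra ℂ (BGen I)) (borcherdsRels A)

/-- The Borcherds algebra `𝔤(A)` of a Borcherds Cartan matrix `A`. -/
noncomputable abbrev BorcherdsAlgebra {I : Type*} (A : I → I → ℝ) :=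
  FreeLieAlgebra ℂ (BGen I) ⧸ borcherdsIdeal A

/-- The generator `e i` of `𝔤(A)`. -/
noncomputable def gE {I : Type*} (A : I → I → ℝ) (i : I) : BorcherdsAlgebra A :=
  LieSubmodule.Quotient.mk' (borcherdsIdeal A) (of ℂ (BGen.E i))

/-- The generator `f i` of `𝔤(A)`. -/
noncomputable def gF {I : Type*} (A : I → I → ℝ) (i : I) : BorcherdsAlgebra A :=
  LieSubmodule.Quotient.mk' (borcherdsIdeal A) (of ℂ (BGen.F i))

/-- The generator `h i` of `𝔤(A)`. -/
noncomputable def gH {I : Type*} (A : I → I → ℝ) (i : I) : BorcherdsAlgebra A :=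
  LieSubmodule.Quotient.mk' (borcherdsIdeal A) (of ℂ (BGen.H i))

section Stmt4

variable {I : Type*} [LinearOrder I]

/-- The generating set `U⁺ = {ad(e_{j₁})^{ℓ₁}⋯ad(e_{jₙ})^{ℓₙ} e_i}` of the free
subalgebra `𝔲⁺`. -/
noncomputable def Uplus (A : I → I → ℝ) (J : Set I) : Set (BorcherdsAlgebra A) :=
  { x | ∃ (n : ℕ) (js : Fin n → I) (ℓ : Fin n → ℕ) (i : I),
      StrictMono js ∧ (∀ k, js k ∈ J) ∧ (∀ k, 0 < ℓ k) ∧ i ∉ J ∧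
      x = ((List.ofFn fun k =>
              (LieAlgebra.ad ℂ (BorcherdsAlgebra A) (gE A (js k))) ^ (ℓ k)).prod)
            (gE A i) }

/-- The generating set `U⁻` of the free subalgebra `𝔲⁻`. -/
noncomputable def Uminus (A : I → I → ℝ) (J : Set I) : Set (BorcherdsAlgebra A) :=
  { x | ∃ (n : ℕ) (js : Fin n → I) (ℓ : Fin n → ℕ) (i : I),
      StrictMono js ∧ (∀ k, js k ∈ J) ∧ (∀ k, 0 < ℓ k) ∧ i ∉ J ∧
      x = ((List.ofFn fun k =>
              (LieAlgebra.ad ℂ (BorcherdsAlgebra A) (gF A (js k))) ^ (ℓ k)).prod)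
            (gF A i) }

/-- The generators `e j, f j, h j`, `j ∈ J`, of the subalgebra `𝔤_J` (together with
all of `𝔥` this gives the middle summand `𝔤_J + 𝔥`). -/
noncomputable def gJgens (A : I → I → ℝ) (J : Set I) : Set (BorcherdsAlgebra A) :=
  { x | ∃ j ∈ J, x = gE A j ∨ x = gF A j ∨ x = gH A j }

/-! ### Abstract layer: Lie algebras with elements satisfying the Borcherds relations -/

/-- Elements `e, f, h` of a Lie algebra satisfying the (non Serre) relations. -/
structure BRep {K : Type*} (A : K → K → ℝ) {L : Type*} [LieRing L] [LieAlgebra ℂ L]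
    (e f h : K → L) : Prop where
  hh : ∀ i j, ⁅h i, h j⁆ = 0
  he : ∀ i j, ⁅h i, e j⁆ = (A i j : ℂ) • e j
  hf : ∀ i j, ⁅h i, f j⁆ = -((A i j : ℂ) • f j)
  ef : ∀ i j, ⁅e i, f j⁆ = if i = j then h i else 0
  ee : ∀ i j, A i j = 0 → ⁅e i, e j⁆ = 0
  ff : ∀ i j, A i j = 0 → ⁅f i, f j⁆ = 0

theorem BRep.swap {K : Type*} {A : K → K → ℝ} {L : Type*} [LieRing L] [LieAlgebra ℂ L]
    {e f h : K → L} (r : BRep A e f h) : BRep A f e (fun i => - h i) where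
  hh i j := by simp [r.hh]
  he i j := by simp [r.hf]
  hf i j := by simp [r.he]
  ef i j := by
    rw [← lie_skew, r.ef]
    by_cases hij : i = j
    · subst hij; simp
    · have : ¬ j = i := fun hh => hij hh.symm
      simp [hij, this]
  ee := r.ff
  ff := r.ee

theorem brep_gen {K : Type*} (A : K → K → ℝ) : BRep A (gE A) (gF A) (gH A) := by
  have key : ∀ x ∈ borcherdsRels A, LieSubmodule.Quotient.mk' (borcherdsIdeal A) x = 0 := by
    intro x hx
    rw [LieSubmodule.Quotient.mk_eq_zero]
    exact LieSubmodule.subset_lieSpan hx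
  have hbr : ∀ x y : FreeLieAlgebra ℂ (BGen K),
      LieSubmodule.Quotient.mk' (borcherdsIdeal A) ⁅x, y⁆ =
      ⁅LieSubmodule.Quotient.mk' (borcherdsIdeal A) x,
        LieSubmodule.Quotient.mk' (borcherdsIdeal A) y⁆ := fun x y => rfl
  constructor
  · intro i j
    have := key _ ⟨i, j, Or.inl rfl⟩
    rwa [hbr] at this
  · intro i j
    have := key _ ⟨i, j, Or.inr (Or.inl rfl)⟩
    rw [map_sub, hbr, map_smul, sub_eq_zero] at this
    exact this
  · intro i j
    have := key _ ⟨i, j, Or.inr (Or.inr (Or.inl rfl))⟩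
    rw [map_add, hbr, map_smul] at this
    exact eq_neg_of_add_eq_zero_left this
  · intro i j
    have := key _ ⟨i, j, Or.inr (Or.inr (Or.inr (Or.inl rfl)))⟩
    rw [map_sub, hbr, sub_eq_zero] at this
    refine Eq.trans this ?_
    by_cases hij : i = j
    · simp only [hij, if_true]; rfl
    · simp only [hij, if_false, map_zero]
  · intro i j h0
    have := key _ ⟨i, j, Or.inr (Or.inr (Or.inr (Or.inr (Or.inr ⟨h0, Or.inl rfl⟩))))⟩
    rwa [hbr] at this
  · intro i j h0
    have := key _ ⟨i, j, Or.inr (Or.inr (Or.inr (Or.inr (Or.inr ⟨h0, Or.inr rfl⟩))))⟩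
    rwa [hbr] at this

theorem brep_lift {K : Type*} {A : K → K → ℝ} (hd : ∀ i, A i i ≤ 0)
    {L : Type*} [LieRing L] [LieAlgebra ℂ L] {e f h : K → L} (r : BRep A e f h) :
    ∃ φ : BorcherdsAlgebra A →ₗ⁅ℂ⁆ L,
      (∀ i, φ (gE A i) = e i) ∧ (∀ i, φ (gF A i) = f i) ∧ (∀ i, φ (gH A i) = h i) := by
  let ψ : FreeLieAlgebra ℂ (BGen K) →ₗ⁅ℂ⁆ L := FreeLieAlgebra.lift ℂ (fun g =>
    match g with
    | BGen.E i => e i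
    | BGen.F i => f i
    | BGen.H i => h i)
  have hE : ∀ i, ψ (of ℂ (BGen.E i)) = e i := fun i => by simp [ψ]
  have hF : ∀ i, ψ (of ℂ (BGen.F i)) = f i := fun i => by simp [ψ]
  have hH : ∀ i, ψ (of ℂ (BGen.H i)) = h i := fun i => by simp [ψ]
  have hk : borcherdsIdeal A ≤ ψ.ker := by
    refine LieSubmodule.lieSpan_le.2 ?_
    rintro x ⟨i, j, h1 | h1 | h1 | h1 | ⟨n, -, h1, -⟩ | ⟨h0, h1 | h1⟩⟩
    · simp [h1, LieHom.mem_ker, hH, r.hh]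
    · simp [h1, LieHom.mem_ker, hH, hE, r.he, -Complex.coe_smul]
    · simp [h1, LieHom.mem_ker, hH, hF, r.hf, -Complex.coe_smul]
    · by_cases hij : i = j
      · subst hij; simp [h1, LieHom.mem_ker, hH, hE, hF, r.ef]
      · simp [h1, LieHom.mem_ker, hE, hF, r.ef, hij]
    · exact absurd h1 (not_lt.2 (hd i))
    · simp [h1, LieHom.mem_ker, hE, r.ee _ _ h0]
    · simp [h1, LieHom.mem_ker, hF, r.ff _ _ h0]
  let φ0 : BorcherdsAlgebra A →ₗ[ℂ] L :=
    Submodule.liftQ (borcherdsIdeal A).toSubmodule (ψ : FreeLieAlgebra ℂ (BGen K) →ₗ[ℂ] L)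
      (fun x hx => hk hx)
  refine ⟨{ φ0 with map_lie' := ?_ }, hE, hF, hH⟩
  intro x y
  obtain ⟨x, rfl⟩ := LieSubmodule.Quotient.surjective_mk' _ x
  obtain ⟨y, rfl⟩ := LieSubmodule.Quotient.surjective_mk' _ y
  exact ψ.map_lie x y

/-- A subspace containing the generators and stable under their adjoint action is everything. -/
theorem gen_top {K : Type*} (A : K → K → ℝ) (N : Submodule ℂ (BorcherdsAlgebra A))
    (hE : ∀ i, gE A i ∈ N) (hF : ∀ i, gF A i ∈ N) (hH : ∀ i, gH A i ∈ N)
    (aE : ∀ i, ∀ x ∈ N, ⁅gE A i, x⁆ ∈ N) (aF : ∀ i, ∀ x ∈ N, ⁅gF A i, x⁆ ∈ N)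
    (aH : ∀ i, ∀ x ∈ N, ⁅gH A i, x⁆ ∈ N) : N = ⊤ := by
  let S : LieSubalgebra ℂ (BorcherdsAlgebra A) :=
    { carrier := {x | x ∈ N ∧ ∀ y ∈ N, ⁅x, y⁆ ∈ N}
      add_mem' := fun {a b} ha hb => ⟨N.add_mem ha.1 hb.1, fun y hy => by
        rw [add_lie]; exact N.add_mem (ha.2 y hy) (hb.2 y hy)⟩
      zero_mem' := ⟨N.zero_mem, fun y _ => by rw [zero_lie]; exact N.zero_mem⟩
      smul_mem' := fun c x hx => ⟨N.smul_mem c hx.1, fun y hy => by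
        rw [smul_lie]; exact N.smul_mem c (hx.2 y hy)⟩
      lie_mem' := fun {a b} ha hb => ⟨ha.2 b hb.1, fun y hy => by
        rw [lie_lie]; exact N.sub_mem (ha.2 _ (hb.2 y hy)) (hb.2 _ (ha.2 y hy))⟩ }
  let g : FreeLieAlgebra ℂ (BGen K) →ₗ⁅ℂ⁆ S := FreeLieAlgebra.lift ℂ (fun g =>
    match g with
    | BGen.E i => ⟨gE A i, hE i, aE i⟩
    | BGen.F i => ⟨gF A i, hF i, aF i⟩
    | BGen.H i => ⟨gH A i, hH i, aH i⟩)
  let q : FreeLieAlgebra ℂ (BGen K) →ₗ⁅ℂ⁆ BorcherdsAlgebra A :=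
    { (LieSubmodule.Quotient.mk' (borcherdsIdeal A) :
        FreeLieAlgebra ℂ (BGen K) →ₗ[ℂ] BorcherdsAlgebra A) with map_lie' := fun {x y} => rfl }
  have hq : S.incl.comp g = q := by
    refine FreeLieAlgebra.hom_ext ?_
    intro x
    cases x <;> simp [g] <;> rfl
  rw [eq_top_iff]
  rintro x -
  obtain ⟨x, rfl⟩ := LieSubmodule.Quotient.surjective_mk' _ x
  have : LieSubmodule.Quotient.mk' (borcherdsIdeal A) x = (g x : BorcherdsAlgebra A) := by
    have := congrArg (fun F => F x) hq
    exact this.symm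
  rw [this]
  exact (g x).2.1

/-- Iterated brackets. -/
def emL {J : Type*} {L : Type*} [LieRing L] (e : J → L) (l : List J) (y : L) : L :=
  l.foldr (fun j z => ⁅e j, z⁆) y

@[simp] theorem emL_nil {J : Type*} {L : Type*} [LieRing L] (e : J → L) (y : L) :
    emL e [] y = y := rfl

@[simp] theorem emL_cons {J : Type*} {L : Type*} [LieRing L] (e : J → L) (j : J) (l : List J)
    (y : L) : emL e (j :: l) y = ⁅e j, emL e l y⁆ := rfl

theorem emL_append {J : Type*} {L : Type*} [LieRing L] (e : J → L) (l l' : List J) (y : L) :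
    emL e (l ++ l') y = emL e l (emL e l' y) := by
  simp [emL]

theorem emL_perm {J : Type*} {L : Type*} [LieRing L] (e : J → L) (hc : ∀ i j, ⁅e i, e j⁆ = 0)
    {l l' : List J} (hp : l.Perm l') (y : L) : emL e l y = emL e l' y := by
  induction hp with
  | nil => rfl
  | cons x _ ih => simp [ih]
  | swap x z l =>
    simp only [emL_cons]
    rw [leibniz_lie, hc, zero_lie, zero_add]
  | trans _ _ h1 h2 => exact h1.trans h2

/-! ### The generating sets `U⁺`, `U⁻` -/

theorem emL_replicate {J : Type*} {L : Type*} [LieRing L] [LieAlgebra ℂ L] (e : J → L) (j : J)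
    (n : ℕ) (y : L) :
    ((LieAlgebra.ad ℂ L (e j)) ^ n) y = emL e (List.replicate n j) y := by
  induction n with
  | zero => simp
  | succ n ih => rw [pow_succ', Module.End.mul_apply, ih]; simp [List.replicate_succ]

theorem emL_prod {J : Type*} {L : Type*} [LieRing L] [LieAlgebra ℂ L] (e : J → L)
    (y : L) (l : List (J × ℕ)) :
    ((l.map fun p => (LieAlgebra.ad ℂ L (e p.1)) ^ p.2).prod) y =
      emL e ((l.map fun p => List.replicate p.2 p.1).flatten) y := by
  induction l with
  | nil => simp
  | cons p l ih =>
    rw [List.map_cons, List.prod_cons, Module.End.mul_apply, ih, emL_replicate, List.map_cons,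
      List.flatten_cons, emL_append]

theorem Ugen_iff {K : Type*} [LinearOrder K] {L : Type*} [LieRing L] [LieAlgebra ℂ L]
    (e : K → L) (J : Set K) (hc : ∀ i j : J, ⁅e i, e j⁆ = 0) (x : L) :
    (∃ (n : ℕ) (js : Fin n → K) (ℓ : Fin n → ℕ) (i : K),
      StrictMono js ∧ (∀ k, js k ∈ J) ∧ (∀ k, 0 < ℓ k) ∧ i ∉ J ∧
      x = ((List.ofFn fun k => (LieAlgebra.ad ℂ L (e (js k))) ^ (ℓ k)).prod) (e i)) ↔
    ∃ (l : List J) (i : K), i ∉ J ∧ x = emL (fun j : J => e j) l (e i) := by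
  constructor
  · rintro ⟨n, js, ℓ, i, -, hj, -, hi, rfl⟩
    have h1 := emL_prod (fun j : J => e j) (e i)
      (List.ofFn fun k => ((⟨js k, hj k⟩ : J), ℓ k))
    refine ⟨_, i, hi, Eq.trans ?_ h1⟩
    rw [List.map_ofFn]
    rfl
  · rintro ⟨l, i, hi, rfl⟩
    let s : Multiset J := (l : Multiset J)
    let o := s.toFinset.orderIsoOfFin rfl
    refine ⟨s.toFinset.card, fun k => ((o k : J) : K), fun k => s.count (o k : J), i, ?_, ?_, ?_,
      hi, ?_⟩
    · intro a b hab
      have := o.strictMono hab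
      exact this
    · intro k; exact (o k : J).2
    · intro k
      exact Multiset.count_pos.2 (Multiset.mem_toFinset.1 (o k).2)
    · have h1 := emL_prod (fun j : J => e j) (e i)
        (List.ofFn fun k => ((o k : J), s.count (o k : J)))
      rw [List.map_ofFn] at h1
      refine Eq.trans ?_ h1.symm
      refine emL_perm _ hc ?_ _
      rw [← Multiset.coe_eq_coe]
      have h2 : (l : Multiset J) = s := rfl
      rw [h2, List.map_ofFn]
      have h3 : ∀ ll : List (List J), ((ll.flatten : List J) : Multiset J)
          = (ll.map (fun t : List J => (t : Multiset J))).sum := by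
        intro ll
        induction ll with
        | nil => rfl
        | cons a ll ih => rw [List.map_cons, List.sum_cons, ← ih]; rfl
      rw [h3, List.map_ofFn, List.sum_ofFn]
      conv_lhs => rw [← Multiset.toFinset_sum_count_nsmul_eq s]
      rw [← Finset.sum_coe_sort, ← o.toEquiv.sum_comp]
      refine Finset.sum_congr rfl fun k _ => ?_
      simp only [Multiset.nsmul_singleton]
      rfl

/-! ### Spanning -/

/-- The set of iterated brackets. -/
def USet {K : Type*} {L : Type*} [LieRing L] (e : K → L) (J : Set K) : Set L :=
  {x | ∃ (l : List J) (i : K), i ∉ J ∧ x = emL (fun j : J => e j) l (e i)}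

/-- The middle part. -/
def midM {K : Type*} {L : Type*} [LieRing L] [LieAlgebra ℂ L] (e f h : K → L) (J : Set K) :
    Submodule ℂ L :=
  Submodule.span ℂ ((e '' J ∪ f '' J) ∪ Set.range h)

theorem midM_swap {K : Type*} {L : Type*} [LieRing L] [LieAlgebra ℂ L] (e f h : K → L)
    (J : Set K) : midM f e (fun i => - h i) J = midM e f h J := by
  apply le_antisymm
  · refine Submodule.span_le.2 ?_
    rintro x ((⟨j, hj, rfl⟩ | ⟨j, hj, rfl⟩) | ⟨i, rfl⟩)
    · exact Submodule.subset_span (Or.inl (Or.inr ⟨j, hj, rfl⟩))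
    · exact Submodule.subset_span (Or.inl (Or.inl ⟨j, hj, rfl⟩))
    · exact Submodule.neg_mem _ (Submodule.subset_span (Or.inr ⟨i, rfl⟩))
  · refine Submodule.span_le.2 ?_
    rintro x ((⟨j, hj, rfl⟩ | ⟨j, hj, rfl⟩) | ⟨i, rfl⟩)
    · exact Submodule.subset_span (Or.inl (Or.inr ⟨j, hj, rfl⟩))
    · exact Submodule.subset_span (Or.inl (Or.inl ⟨j, hj, rfl⟩))
    · rw [← neg_neg (h i)]
      exact Submodule.neg_mem _ (Submodule.subset_span (Or.inr ⟨i, rfl⟩))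

section Span

variable {K : Type*} {A : K → K → ℝ} {L : Type*} [LieRing L] [LieAlgebra ℂ L]
    {e f h : K → L} (r : BRep A e f h) {J : Set K}

theorem lieSpan_der (U : Set L) (z : L)
    (hz : ∀ x ∈ U, ⁅z, x⁆ ∈ LieSubalgebra.lieSpan ℂ L U) (x : L)
    (hx : x ∈ LieSubalgebra.lieSpan ℂ L U) : ⁅z, x⁆ ∈ LieSubalgebra.lieSpan ℂ L U := by
  induction hx using LieSubalgebra.lieSpan_induction with
  | mem x hx => exact hz x hx
  | zero => simp
  | add x y _ _ h1 h2 => rw [lie_add]; exact add_mem h1 h2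
  | smul a x _ h1 => rw [lie_smul]; exact LieSubalgebra.smul_mem _ _ h1
  | lie x y hx hy h1 h2 =>
    rw [leibniz_lie]
    exact add_mem (LieSubalgebra.lie_mem _ h1 hy) (LieSubalgebra.lie_mem _ hx h2)

set_option linter.unusedSectionVars false

include r

theorem h_emL (i : K) (l : List J) (k : K) :
    ∃ c : ℂ, ⁅h i, emL (fun j : J => e j) l (e k)⁆ = c • emL (fun j : J => e j) l (e k) := by
  induction l with
  | nil => exact ⟨_, r.he i k⟩
  | cons j l ih =>
    obtain ⟨c, hc⟩ := ih
    refine ⟨(A i j : ℂ) + c, ?_⟩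
    rw [emL_cons, leibniz_lie, hc, r.he, smul_lie, lie_smul, add_smul]

theorem e_u (i : K) (x : L) (hx : x ∈ LieSubalgebra.lieSpan ℂ L (USet e J)) :
    ⁅e i, x⁆ ∈ LieSubalgebra.lieSpan ℂ L (USet e J) := by
  by_cases hi : i ∈ J
  · refine lieSpan_der _ _ ?_ x hx
    rintro _ ⟨l, k, hk, rfl⟩
    exact LieSubalgebra.subset_lieSpan ⟨⟨i, hi⟩ :: l, k, hk, rfl⟩
  · exact LieSubalgebra.lie_mem _ (LieSubalgebra.subset_lieSpan ⟨[], i, hi, rfl⟩) hx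

theorem h_u (i : K) (x : L) (hx : x ∈ LieSubalgebra.lieSpan ℂ L (USet e J)) :
    ⁅h i, x⁆ ∈ LieSubalgebra.lieSpan ℂ L (USet e J) := by
  refine lieSpan_der _ _ ?_ x hx
  rintro _ ⟨l, k, hk, rfl⟩
  obtain ⟨c, hc⟩ := h_emL r i l k
  rw [hc]
  exact LieSubalgebra.smul_mem _ _ (LieSubalgebra.subset_lieSpan ⟨l, k, hk, rfl⟩)

theorem fe (i j : K) : ⁅f i, e j⁆ = if i = j then - h i else 0 := r.swap.ef i j

theorem fJ_u (i : K) (hi : i ∈ J) (x : L) (hx : x ∈ LieSubalgebra.lieSpan ℂ L (USet e J)) :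
    ⁅f i, x⁆ ∈ LieSubalgebra.lieSpan ℂ L (USet e J) := by
  refine lieSpan_der _ _ ?_ x hx
  rintro _ ⟨l, k, hk, rfl⟩
  induction l with
  | nil =>
    have : ¬ i = k := by rintro rfl; exact hk hi
    rw [emL_nil, fe r, if_neg this]; exact zero_mem _
  | cons j l ih =>
    rw [emL_cons, leibniz_lie]
    refine add_mem ?_ (e_u r _ _ ih)
    rw [fe r]
    split_ifs
    · rw [neg_lie]
      exact neg_mem (h_u r _ _ (LieSubalgebra.subset_lieSpan ⟨l, k, hk, rfl⟩))
    · rw [zero_lie]; exact zero_mem _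

theorem m_u (z : L) (hz : z ∈ midM e f h J) (x : L)
    (hx : x ∈ LieSubalgebra.lieSpan ℂ L (USet e J)) :
    ⁅z, x⁆ ∈ LieSubalgebra.lieSpan ℂ L (USet e J) := by
  induction hz using Submodule.span_induction with
  | mem z hz =>
    rcases hz with ((⟨j, hj, rfl⟩ | ⟨j, hj, rfl⟩) | ⟨i, rfl⟩)
    · exact e_u r _ _ hx
    · exact fJ_u r _ hj _ hx
    · exact h_u r _ _ hx
  | zero => rw [zero_lie]; exact zero_mem _
  | add a b _ _ h1 h2 => rw [add_lie]; exact add_mem h1 h2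
  | smul c a _ h1 => rw [smul_lie]; exact LieSubalgebra.smul_mem _ _ h1

theorem h_mem_mid (i : K) : h i ∈ midM e f h J := Submodule.subset_span (Or.inr ⟨i, rfl⟩)

theorem h_m (i : K) (x : L) (hx : x ∈ midM e f h J) : ⁅h i, x⁆ ∈ midM e f h J := by
  induction hx using Submodule.span_induction with
  | mem z hz =>
    have hz' : z ∈ midM e f h J := Submodule.subset_span hz
    rcases hz with ((⟨j, hj, rfl⟩ | ⟨j, hj, rfl⟩) | ⟨k, rfl⟩)
    · rw [r.he]; exact Submodule.smul_mem _ _ hz'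
    · rw [r.hf]; exact neg_mem (Submodule.smul_mem _ _ hz')
    · rw [r.hh]; exact zero_mem _
  | zero => rw [lie_zero]; exact zero_mem _
  | add a b _ _ h1 h2 => rw [lie_add]; exact add_mem h1 h2
  | smul c a _ h1 => rw [lie_smul]; exact Submodule.smul_mem _ _ h1

theorem eJ_m (hz : ∀ i j, A i j = 0 ↔ i ∈ J ∧ j ∈ J) (i : K) (hi : i ∈ J) (x : L)
    (hx : x ∈ midM e f h J) : ⁅e i, x⁆ ∈ midM e f h J := by
  induction hx using Submodule.span_induction with
  | mem z hz' =>
    rcases hz' with ((⟨j, hj, rfl⟩ | ⟨j, hj, rfl⟩) | ⟨k, rfl⟩)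
    · rw [r.ee _ _ ((hz _ _).2 ⟨hi, hj⟩)]; exact zero_mem _
    · rw [r.ef]
      split_ifs
      · exact h_mem_mid r i
      · exact zero_mem _
    · rw [← lie_skew, r.he]
      exact neg_mem (Submodule.smul_mem _ _ (Submodule.subset_span (Or.inl (Or.inl ⟨i, hi, rfl⟩))))
  | zero => rw [lie_zero]; exact zero_mem _
  | add a b _ _ h1 h2 => rw [lie_add]; exact add_mem h1 h2
  | smul c a _ h1 => rw [lie_smul]; exact Submodule.smul_mem _ _ h1

theorem e_m (hz : ∀ i j, A i j = 0 ↔ i ∈ J ∧ j ∈ J) (i : K) (x : L)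
    (hx : x ∈ midM e f h J) :
    ⁅e i, x⁆ ∈ midM e f h J ⊔ (LieSubalgebra.lieSpan ℂ L (USet e J)).toSubmodule := by
  by_cases hi : i ∈ J
  · exact Submodule.mem_sup_left (eJ_m r hz i hi x hx)
  · refine Submodule.mem_sup_right ?_
    have : e i ∈ LieSubalgebra.lieSpan ℂ L (USet e J) :=
      LieSubalgebra.subset_lieSpan ⟨[], i, hi, rfl⟩
    rw [← lie_skew]
    exact neg_mem (m_u r x hx _ this)

theorem f_u (hz : ∀ i j, A i j = 0 ↔ i ∈ J ∧ j ∈ J) (i : K) (x : L)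
    (hx : x ∈ LieSubalgebra.lieSpan ℂ L (USet e J)) :
    ⁅f i, x⁆ ∈ midM e f h J ⊔ (LieSubalgebra.lieSpan ℂ L (USet e J)).toSubmodule := by
  by_cases hi : i ∈ J
  · exact Submodule.mem_sup_right (fJ_u r i hi x hx)
  have key : ∀ w ∈ midM e f h J ⊔ (LieSubalgebra.lieSpan ℂ L (USet e J)).toSubmodule,
      ∀ y ∈ LieSubalgebra.lieSpan ℂ L (USet e J), ⁅w, y⁆ ∈ LieSubalgebra.lieSpan ℂ L (USet e J) := by
    intro w hw y hy
    obtain ⟨a, ha, b, hb, rfl⟩ := Submodule.mem_sup.1 hw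
    rw [add_lie]
    exact add_mem (m_u r a ha y hy) (LieSubalgebra.lie_mem _ hb hy)
  induction hx using LieSubalgebra.lieSpan_induction with
  | mem x hx =>
    obtain ⟨l, k, hk, rfl⟩ := hx
    refine Submodule.mem_sup_left ?_
    induction l with
    | nil =>
      rw [emL_nil, fe r]
      split_ifs
      · exact neg_mem (h_mem_mid r i)
      · exact zero_mem _
    | cons j l ih =>
      have : ¬ i = (j : K) := by rintro rfl; exact hi j.2
      rw [emL_cons, leibniz_lie, fe r, if_neg this, zero_lie, zero_add]
      exact eJ_m r hz _ j.2 _ ih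
  | zero => rw [lie_zero]; exact zero_mem _
  | add x y _ _ h1 h2 => rw [lie_add]; exact add_mem h1 h2
  | smul a x _ h1 => rw [lie_smul]; exact Submodule.smul_mem _ _ h1
  | lie x y hx hy h1 h2 =>
    rw [leibniz_lie]
    refine Submodule.mem_sup_right ?_
    refine add_mem (key _ h1 _ hy) ?_
    rw [← lie_skew]
    exact neg_mem (key _ h2 _ hx)

omit r in
theorem lieSpan_gens_le_mid (hz : ∀ i j, A i j = 0 ↔ i ∈ J ∧ j ∈ J) (r : BRep A e f h) :
    (LieSubalgebra.lieSpan ℂ L {x | ∃ j ∈ J, x = e j ∨ x = f j ∨ x = h j}).toSubmodule ⊔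
      Submodule.span ℂ (Set.range h) = midM e f h J := by
  apply le_antisymm
  · refine sup_le ?_ (Submodule.span_mono (fun x hx => Or.inr hx))
    have hf : ∀ i ∈ J, ∀ x ∈ midM e f h J, ⁅f i, x⁆ ∈ midM e f h J := by
      intro i hi x hx
      rw [← midM_swap] at hx ⊢
      exact eJ_m r.swap hz i hi x hx
    let S : LieSubalgebra ℂ L :=
      { midM e f h J with
        lie_mem' := by
          intro a b ha hb
          change a ∈ midM e f h J at ha
          change b ∈ midM e f h J at hb
          change ⁅a, b⁆ ∈ midM e f h J
          induction ha using Submodule.span_induction with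
          | mem z hz' =>
            rcases hz' with ((⟨j, hj, rfl⟩ | ⟨j, hj, rfl⟩) | ⟨k, rfl⟩)
            · exact eJ_m r hz _ hj _ hb
            · exact hf _ hj _ hb
            · exact h_m r _ _ hb
          | zero => rw [zero_lie]; exact zero_mem _
          | add a b _ _ h1 h2 => rw [add_lie]; exact add_mem h1 h2
          | smul c a _ h1 => rw [smul_lie]; exact Submodule.smul_mem _ _ h1 }
    have : LieSubalgebra.lieSpan ℂ L {x | ∃ j ∈ J, x = e j ∨ x = f j ∨ x = h j} ≤ S := by
      refine LieSubalgebra.lieSpan_le.2 ?_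
      rintro x ⟨j, hj, rfl | rfl | rfl⟩
      · exact Submodule.subset_span (Or.inl (Or.inl ⟨j, hj, rfl⟩))
      · exact Submodule.subset_span (Or.inl (Or.inr ⟨j, hj, rfl⟩))
      · exact h_mem_mid r j
    exact this
  · refine Submodule.span_le.2 ?_
    rintro x ((⟨j, hj, rfl⟩ | ⟨j, hj, rfl⟩) | ⟨i, rfl⟩)
    · exact Submodule.mem_sup_left (LieSubalgebra.subset_lieSpan ⟨j, hj, Or.inl rfl⟩)
    · exact Submodule.mem_sup_left (LieSubalgebra.subset_lieSpan ⟨j, hj, Or.inr (Or.inl rfl)⟩)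
    · exact Submodule.mem_sup_right (Submodule.subset_span ⟨i, rfl⟩)

end Span

theorem span_top {K : Type*} {A : K → K → ℝ} {J : Set K}
    (hz : ∀ i j, A i j = 0 ↔ i ∈ J ∧ j ∈ J) :
    (LieSubalgebra.lieSpan ℂ (BorcherdsAlgebra A) (USet (gF A) J)).toSubmodule ⊔
      (midM (gE A) (gF A) (gH A) J ⊔
        (LieSubalgebra.lieSpan ℂ (BorcherdsAlgebra A) (USet (gE A) J)).toSubmodule) = ⊤ := by
  have r := brep_gen A
  set P := (LieSubalgebra.lieSpan ℂ (BorcherdsAlgebra A) (USet (gE A) J)) with hP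
  set Q := (LieSubalgebra.lieSpan ℂ (BorcherdsAlgebra A) (USet (gF A) J)) with hQ
  set M := midM (gE A) (gF A) (gH A) J with hM
  have hPle : M ⊔ P.toSubmodule ≤ Q.toSubmodule ⊔ (M ⊔ P.toSubmodule) := le_sup_right
  have hQle : M ⊔ Q.toSubmodule ≤ Q.toSubmodule ⊔ (M ⊔ P.toSubmodule) :=
    sup_le (le_sup_left.trans le_sup_right) le_sup_left
  have hMM : midM (gF A) (gE A) (fun i => - gH A i) J = M := midM_swap _ _ _ _
  have split : ∀ z : BorcherdsAlgebra A, (∀ x ∈ Q, ⁅z, x⁆ ∈ Q.toSubmodule ⊔ (M ⊔ P.toSubmodule)) →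
      (∀ x ∈ M, ⁅z, x⁆ ∈ Q.toSubmodule ⊔ (M ⊔ P.toSubmodule)) →
      (∀ x ∈ P, ⁅z, x⁆ ∈ Q.toSubmodule ⊔ (M ⊔ P.toSubmodule)) →
      ∀ x ∈ Q.toSubmodule ⊔ (M ⊔ P.toSubmodule),
        ⁅z, x⁆ ∈ Q.toSubmodule ⊔ (M ⊔ P.toSubmodule) := by
    intro z h1 h2 h3 x hx
    obtain ⟨a, ha, b, hb, rfl⟩ := Submodule.mem_sup.1 hx
    obtain ⟨b', hb', c, hc, rfl⟩ := Submodule.mem_sup.1 hb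
    rw [lie_add, lie_add]
    exact add_mem (h1 _ ha) (add_mem (h2 _ hb') (h3 _ hc))
  apply gen_top
  · intro i
    apply hPle
    by_cases hi : i ∈ J
    · exact Submodule.mem_sup_left (Submodule.subset_span (Or.inl (Or.inl ⟨i, hi, rfl⟩)))
    · exact Submodule.mem_sup_right (LieSubalgebra.subset_lieSpan ⟨[], i, hi, rfl⟩)
  · intro i
    apply hQle
    by_cases hi : i ∈ J
    · exact Submodule.mem_sup_left (Submodule.subset_span (Or.inl (Or.inr ⟨i, hi, rfl⟩)))
    · exact Submodule.mem_sup_right (LieSubalgebra.subset_lieSpan ⟨[], i, hi, rfl⟩)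
  · intro i
    exact hPle (Submodule.mem_sup_left (h_mem_mid r i))
  · intro i
    refine split _ ?_ ?_ ?_
    · intro x hx
      have := f_u r.swap hz i x hx
      rw [hMM] at this
      exact hQle this
    · intro x hx; exact hPle (e_m r hz i x hx)
    · intro x hx; exact hPle (Submodule.mem_sup_right (e_u r i x hx))
  · intro i
    refine split _ ?_ ?_ ?_
    · intro x hx; exact hQle (Submodule.mem_sup_right (e_u r.swap i x hx))
    · intro x hx
      rw [← hMM] at hx
      have := e_m r.swap hz i x hx
      rw [hMM] at this
      exact hQle this
    · intro x hx; exact hPle (f_u r hz i x hx)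
  · intro i
    refine split _ ?_ ?_ ?_
    · intro x hx
      have : ⁅- gH A i, x⁆ ∈ Q := h_u r.swap i x hx
      rw [neg_lie] at this
      exact hQle (Submodule.mem_sup_right (by simpa using neg_mem this))
    · intro x hx; exact hPle (Submodule.mem_sup_left (h_m r i x hx))
    · intro x hx; exact hPle (Submodule.mem_sup_right (h_u r i x hx))

/-! ### Graded pieces -/

/-- The sum of the positive pieces of a `ℤ`-filtered family is a subalgebra. -/
def posPart {L : Type*} [LieRing L] [LieAlgebra ℂ L] (V : ℤ → Submodule ℂ L)
    (hV : ∀ n m x y, x ∈ V n → y ∈ V m → ⁅x, y⁆ ∈ V (n + m)) : LieSubalgebra ℂ L :=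
  { (⨆ n ∈ {n : ℤ | 0 < n}, V n) with
    lie_mem' := by
      intro a b ha hb
      change a ∈ (⨆ n ∈ {n : ℤ | 0 < n}, V n) at ha
      change b ∈ (⨆ n ∈ {n : ℤ | 0 < n}, V n) at hb
      change ⁅a, b⁆ ∈ (⨆ n ∈ {n : ℤ | 0 < n}, V n)
      rw [← iSup_subtype''] at ha hb
      induction ha using Submodule.iSup_induction' with
      | zero => rw [zero_lie]; exact zero_mem _
      | add x y _ _ h1 h2 => rw [add_lie]; exact add_mem h1 h2
      | mem n x hx =>
        induction hb using Submodule.iSup_induction' with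
        | zero => rw [lie_zero]; exact zero_mem _
        | add x y _ _ h1 h2 => rw [lie_add]; exact add_mem h1 h2
        | mem m y hy =>
          have hle : V (n + m) ≤ ⨆ n ∈ {n : ℤ | 0 < n}, V n :=
            le_biSup V (i := (n : ℤ) + m) (show (0 : ℤ) < n + m from add_pos n.2 m.2)
          exact hle (hV _ _ _ _ hx hy) }

theorem mem_posPart {L : Type*} [LieRing L] [LieAlgebra ℂ L] (V : ℤ → Submodule ℂ L)
    (hV : ∀ n m x y, x ∈ V n → y ∈ V m → ⁅x, y⁆ ∈ V (n + m)) (n : ℤ) (hn : 0 < n) (x : L)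
    (hx : x ∈ V n) : x ∈ posPart V hV := by
  have hle : V n ≤ ⨆ n ∈ {n : ℤ | 0 < n}, V n := le_biSup V (i := n) hn
  exact hle hx

/-! ### The free Lie algebra acts faithfully on words (Dynkin) -/

section EndSection

attribute [local instance] LieRing.ofAssociativeRing

/-- Left multiplication by a letter. -/
noncomputable def Lop {X : Type*} (x : X) : Module.End ℂ (List X →₀ ℂ) :=
  Finsupp.lmapDomain ℂ ℂ (fun w => x :: w)

theorem Lop_single {X : Type*} (x : X) (w : List X) :
    Lop x (Finsupp.single w 1) = Finsupp.single (x :: w) 1 := by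
  simp [Lop]

/-- Right normed brackets of words. -/
noncomputable def dynWord {X F : Type*} [LieRing F] (q : X → F) : List X → F
  | [] => 0
  | x :: w => if w = [] then q x else ⁅q x, dynWord q w⁆

theorem dynkin_inj {U X : Type*} (g : U → X) (hg : Function.Injective g) :
    Function.Injective (FreeLieAlgebra.lift ℂ (fun u => Lop (g u))) := by
  set ρ : FreeLieAlgebra ℂ U →ₗ⁅ℂ⁆ Module.End ℂ (List X →₀ ℂ) := FreeLieAlgebra.lift ℂ (fun u => Lop (g u)) with hρ
  have hρof : ∀ u, ρ (of ℂ u) = Lop (g u) := fun u => by simp [hρ]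
  let q : X → FreeLieAlgebra ℂ U := Function.extend g (of ℂ) 0
  have hq : ∀ u, q (g u) = of ℂ u := fun u => hg.extend_apply _ _ u
  let P : (List X →₀ ℂ) →ₗ[ℂ] FreeLieAlgebra ℂ U := Finsupp.linearCombination ℂ (dynWord q)
  let ε : (List X →₀ ℂ) →ₗ[ℂ] ℂ := Finsupp.lapply []
  have hεL : ∀ x m, ε (Lop x m) = 0 := by
    intro x m
    induction m using Finsupp.induction_linear with
    | zero => simp
    | add a b h1 h2 => simp [h1, h2]
    | single w c =>
      rw [← mul_one c, ← smul_eq_mul, ← Finsupp.smul_single, map_smul, Lop_single]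
      simp [ε]
  have hPL : ∀ x m, P (Lop x m) = ⁅q x, P m⁆ + ε m • q x := by
    intro x m
    induction m using Finsupp.induction_linear with
    | zero => simp
    | add a b h1 h2 => simp only [map_add, h1, h2, lie_add, add_smul]; abel
    | single w c =>
      rw [← mul_one c, ← smul_eq_mul, ← Finsupp.smul_single, map_smul, Lop_single]
      simp only [map_smul, lie_smul, P, Finsupp.linearCombination_single, one_smul, dynWord]
      by_cases hw : w = []
      · subst hw; simp [dynWord, ε]
      · have : ¬ w = [] := hw
        simp [hw, ε]
  -- main induction
  have hall : ∀ l : FreeLieAlgebra ℂ U, (∀ m, ε (ρ l m) = 0) ∧ (∀ m, P (ρ l m) = ⁅l, P m⁆ + ε m • P (ρ l (Finsupp.single [] 1))) := by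
    let S : LieSubalgebra ℂ (FreeLieAlgebra ℂ U) :=
      { carrier := {l | (∀ m, ε (ρ l m) = 0) ∧
          (∀ m, P (ρ l m) = ⁅l, P m⁆ + ε m • P (ρ l (Finsupp.single [] 1)))}
        zero_mem' := by constructor <;> intro m <;> simp
        add_mem' := by
          rintro a b ⟨h1, h2⟩ ⟨h3, h4⟩
          refine ⟨fun m => by simp [h1, h3], fun m => ?_⟩
          simp only [map_add, LinearMap.add_apply, h2 m, h4 m, add_lie, smul_add]; abel
        smul_mem' := by
          rintro c a ⟨h1, h2⟩
          refine ⟨fun m => by simp [h1], fun m => ?_⟩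
          simp only [map_smul, LinearMap.smul_apply, h2 m, smul_lie, smul_add]
          rw [smul_comm]
        lie_mem' := by
          rintro a b ⟨h1, h2⟩ ⟨h3, h4⟩
          have hab : ∀ m, ρ ⁅a, b⁆ m = ρ a (ρ b m) - ρ b (ρ a m) := by
            intro m; rw [LieHom.map_lie, Ring.lie_def]; rfl
          refine ⟨fun m => by rw [hab, map_sub, h1, h3, sub_zero], fun m => ?_⟩
          rw [hab, hab, map_sub, map_sub, h2 (ρ b m), h4 (ρ a m), h2 (ρ b _), h4 (ρ a _), h1, h1,
            h3, h3, h2 m, h4 m]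
          simp only [zero_smul, add_zero, lie_add, lie_smul, smul_sub, lie_lie]
          abel }
    have hS : ∀ u, of ℂ u ∈ S := by
      intro u
      refine ⟨fun m => by rw [hρof]; exact hεL _ _, fun m => ?_⟩
      rw [hρof, hPL, hPL, hq]
      simp [P, ε, dynWord]
    let g' : FreeLieAlgebra ℂ U →ₗ⁅ℂ⁆ S := FreeLieAlgebra.lift ℂ (fun u => ⟨of ℂ u, hS u⟩)
    have hg' : S.incl.comp g' = LieHom.id := by
      refine FreeLieAlgebra.hom_ext ?_
      intro u
      simp [g']
    intro l
    have : l = (g' l : FreeLieAlgebra ℂ U) := by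
      have := congrArg (fun G => G l) hg'
      exact this.symm
    rw [this]
    exact (g' l).2
  let D : Module.End ℂ (FreeLieAlgebra ℂ U) :=
    { toFun := fun l => P (ρ l (Finsupp.single [] 1))
      map_add' := by intro a b; simp
      map_smul' := by intro a b; simp }
  have hDdef : ∀ l, D l = P (ρ l (Finsupp.single [] 1)) := fun l => rfl
  have hDof : ∀ u, D (of ℂ u) = of ℂ u := by
    intro u
    rw [hDdef, hρof, hPL, hq]
    simp [P, ε, dynWord]
  have hDlie : ∀ a b, D ⁅a, b⁆ = ⁅D a, b⁆ + ⁅a, D b⁆ := by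
    intro a b
    have hab : ∀ m, ρ ⁅a, b⁆ m = ρ a (ρ b m) - ρ b (ρ a m) := by
      intro m; rw [LieHom.map_lie, Ring.lie_def]; rfl
    rw [hDdef, hab, map_sub, (hall a).2, (hall b).2 (ρ a _), (hall a).1, (hall b).1, ← hDdef,
      ← hDdef, ← lie_skew b]
    simp only [zero_smul, add_zero]; abel
  let V : ℤ → Submodule ℂ (FreeLieAlgebra ℂ U) := fun n => D.eigenspace (n : ℂ)
  have hV : ∀ n m x y, x ∈ V n → y ∈ V m → ⁅x, y⁆ ∈ V (n + m) := by
    intro n m x y hx hy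
    rw [Module.End.mem_eigenspace_iff] at hx hy ⊢
    rw [hDlie, hx, hy, smul_lie, lie_smul, ← add_smul]
    push_cast; rfl
  have hpos : ∀ l : FreeLieAlgebra ℂ U, l ∈ posPart V hV := by
    let g' : FreeLieAlgebra ℂ U →ₗ⁅ℂ⁆ posPart V hV := FreeLieAlgebra.lift ℂ (fun u => ⟨of ℂ u,
      mem_posPart V hV 1 one_pos _ (by
        rw [Module.End.mem_eigenspace_iff, hDof]; simp)⟩)
    have hg' : (posPart V hV).incl.comp g' = LieHom.id := by
      refine FreeLieAlgebra.hom_ext ?_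
      intro u
      simp [g']
    intro l
    have : l = (g' l : FreeLieAlgebra ℂ U) := by
      have := congrArg (fun G => G l) hg'
      exact this.symm
    rw [this]
    exact (g' l).2
  rw [injective_iff_map_eq_zero]
  intro l hl
  have h0 : l ∈ V 0 := by
    rw [Module.End.mem_eigenspace_iff, hDdef, hl]; simp
  have hind : iSupIndep V :=
    (Module.End.eigenspaces_iSupIndep D).comp (f := fun n : ℤ => (n : ℂ)) Int.cast_injective
  have hdis := hind.disjoint_biSup (x := 0) (y := {n : ℤ | 0 < n}) (by simp)
  exact (Submodule.disjoint_def.1 hdis) l h0 (hpos l)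

end EndSection

/-! ### The model -/

universe uu

/-- Abstract form of the Lie algebra of operators on words in the alphabet `X`: left
multiplications `Lx x`, operators `Op c` killing the empty word with prescribed commutators
with the left multiplications. -/
structure WordMod (X : Type uu) (L : Type uu) [LieRing L] [LieAlgebra ℂ L] where
  Lx : X → L
  Op : (X → L) → L
  P : LieSubalgebra ℂ L
  Op_mem : ∀ c, Op c ∈ P
  Op_lie : ∀ c x, ⁅Op c, Lx x⁆ = c x
  ext : ∀ a ∈ P, ∀ b ∈ P, (∀ x, ⁅a, Lx x⁆ = ⁅b, Lx x⁆) → a = b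
  indep : LinearIndependent ℂ Lx
  dyn : ∀ {U : Type uu} (g : U → X), Function.Injective g →
    Function.Injective (FreeLieAlgebra.lift ℂ (fun u => Lx (g u)))

section Model

variable {K : Type uu} (A : K → K → ℝ) (lam : K → ℂ) (J : Set K)
  {L : Type uu} [LieRing L] [LieAlgebra ℂ L] (W : WordMod (Multiset J × Option K) L)

/-- extended matrix -/
noncomputable def bext (i : K) (k : Option K) : ℂ := k.elim (lam i) (fun k => (A i k : ℂ))

/-- weight of a letter -/
noncomputable def wtX (i : K) (x : Multiset J × Option K) : ℂ :=
  bext A lam i x.2 + (x.1.map (fun j : J => (A i j : ℂ))).sum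

/-- operator of `h i` -/
noncomputable def hT (i : K) : L :=
  W.Op (fun x => wtX A lam J i x • W.Lx x)

/-- operator of `e j`, `j ∈ J` -/
noncomputable def dT (j : J) : L :=
  W.Op (fun x => W.Lx (j ::ₘ x.1, x.2))

/-- operator of `e i` -/
noncomputable def eT (i : K) : L :=
  if h : i ∈ J then dT J W ⟨i, h⟩ else W.Lx (0, some i)

/-- operator of `f j`, `j ∈ J` -/
noncomputable def gT (j : J) : L :=
  W.Op (fun x => (-((x.1.count j : ℂ) * bext A lam j x.2)) • W.Lx (x.1.erase j, x.2))

/-- commutator of `f i`, `i ∉ J`, with letters -/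
noncomputable def zT (i : K) (s : Multiset J) :
    L :=
  emL (dT J W) s.toList (- hT A lam J W i)

/-- operator of `f i` -/
noncomputable def fT (i : K) : L :=
  if h : i ∈ J then gT A lam J W ⟨i, h⟩ else
    W.Op (fun x => if x.2 = some i then zT A lam J W i x.1 else 0)

theorem hT_L (i : K) (x : Multiset J × Option K) : ⁅hT A lam J W i, W.Lx x⁆ = wtX A lam J i x • W.Lx x := W.Op_lie _ _
theorem dT_L (j : J) (x : Multiset J × Option K) : ⁅dT J W j, W.Lx x⁆ = W.Lx (j ::ₘ x.1, x.2) := W.Op_lie _ _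
theorem gT_L (j : J) (x : Multiset J × Option K) : ⁅gT A lam J W j, W.Lx x⁆ =
    (-((x.1.count j : ℂ) * bext A lam j x.2)) • W.Lx (x.1.erase j, x.2) := W.Op_lie _ _

theorem dd (i j : J) : ⁅dT J W i, dT J W j⁆ = 0 := by
  refine W.ext _ (by exact W.P.lie_mem (W.Op_mem _) (W.Op_mem _)) _ W.P.zero_mem fun x => ?_
  rw [lie_lie, dT_L, dT_L, dT_L, dT_L, zero_lie, sub_eq_zero, Multiset.cons_swap]

theorem hT_d (i : K) (j : J) : ⁅hT A lam J W i, dT J W j⁆ = (A i j : ℂ) • dT J W j := by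
  refine W.ext _ (by exact W.P.lie_mem (W.Op_mem _) (W.Op_mem _)) _ ?_ fun x => ?_
  · exact W.P.smul_mem _ (W.Op_mem _)
  · rw [lie_lie, dT_L, hT_L, hT_L, lie_smul, dT_L, smul_lie, dT_L, ← sub_smul]
    congr 1
    simp only [wtX, Multiset.map_cons, Multiset.sum_cons]
    ring

theorem hT_h (i j : K) : ⁅hT A lam J W i, hT A lam J W j⁆ = 0 := by
  refine W.ext _ (by exact W.P.lie_mem (W.Op_mem _) (W.Op_mem _)) _ W.P.zero_mem fun x => ?_
  rw [lie_lie, hT_L, hT_L, lie_smul, lie_smul, hT_L, hT_L, smul_comm, sub_self, zero_lie]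

theorem hT_g (hsym : ∀ i j, A i j = A j i) (i : K) (j : J) :
    ⁅hT A lam J W i, gT A lam J W j⁆ = -((A i j : ℂ) • gT A lam J W j) := by
  refine W.ext _ (by exact W.P.lie_mem (W.Op_mem _) (W.Op_mem _)) _ ?_ fun x => ?_
  · exact W.P.neg_mem (W.P.smul_mem _ (W.Op_mem _))
  · rw [lie_lie, gT_L, hT_L, lie_smul, lie_smul, gT_L, hT_L, neg_lie, smul_lie, gT_L]
    by_cases hj : j ∈ x.1
    · obtain ⟨s, hs⟩ := Multiset.exists_cons_of_mem hj
      obtain ⟨x1, x2⟩ := x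
      subst hs
      simp only [smul_smul, ← sub_smul, ← neg_smul]
      congr 1
      simp only [wtX, Multiset.map_cons, Multiset.sum_cons, Multiset.erase_cons_head]
      ring
    · simp [Multiset.count_eq_zero_of_notMem hj]

theorem gg (i j : J) : ⁅gT A lam J W i, gT A lam J W j⁆ = 0 := by
  by_cases hij : i = j
  · subst hij; exact lie_self _
  have hji : j ≠ i := fun h => hij h.symm
  refine W.ext _ (by exact W.P.lie_mem (W.Op_mem _) (W.Op_mem _)) _ W.P.zero_mem fun x => ?_
  rw [lie_lie, gT_L, gT_L, lie_smul, lie_smul, gT_L, gT_L, zero_lie]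
  simp only [smul_smul, Multiset.count_erase_of_ne hij, Multiset.count_erase_of_ne hji]
  rw [Multiset.erase_comm, ← sub_smul]
  convert zero_smul ℂ _
  ring

theorem dg (hz : ∀ i j, A i j = 0 ↔ i ∈ J ∧ j ∈ J) (i j : J) :
    ⁅dT J W i, gT A lam J W j⁆ = if (i : K) = j then hT A lam J W i else 0 := by
  refine W.ext _ (by exact W.P.lie_mem (W.Op_mem _) (W.Op_mem _)) _ ?_ fun x => ?_
  · split_ifs
    · exact W.Op_mem _
    · exact W.P.zero_mem
  · rw [lie_lie, dT_L, gT_L, lie_smul, dT_L, gT_L]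
    obtain ⟨s, k⟩ := x
    by_cases hij : i = j
    · subst hij
      rw [if_pos rfl, hT_L]
      have hsum : (s.map (fun j : J => (A i j : ℂ))).sum = 0 := by
        apply Multiset.sum_eq_zero
        intro y hy
        obtain ⟨j, -, rfl⟩ := Multiset.mem_map.1 hy
        simp [(hz i j).2 ⟨i.2, j.2⟩]
      simp only [wtX, hsum, add_zero, Multiset.count_cons_self, Multiset.erase_cons_head]
      by_cases hs : i ∈ s
      · rw [Multiset.cons_erase hs, ← sub_smul]
        congr 1
        push_cast; ring
      · simp [Multiset.count_eq_zero_of_notMem hs]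
    · have hji : ¬ (i : K) = j := fun h => hij (Subtype.ext h)
      have hji' : j ≠ i := fun h => hij h.symm
      rw [if_neg hji, zero_lie]
      simp only [Multiset.count_cons_of_ne hji', Multiset.erase_cons_tail s hij, sub_self]

theorem zT_zero (i : K) : zT A lam J W i 0 = - hT A lam J W i := by
  simp [zT]

theorem zT_cons (i : K) (j : J) (s : Multiset J) :
    zT A lam J W i (j ::ₘ s) = ⁅dT J W j, zT A lam J W i s⁆ := by
  have : (j ::ₘ s).toList.Perm (j :: s.toList) := by
    rw [← Multiset.coe_eq_coe, Multiset.coe_toList, ← Multiset.cons_coe, Multiset.coe_toList]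
  rw [zT, emL_perm _ (dd J W) this, emL_cons, zT]

theorem hT_z (i' i : K) (s : Multiset J) :
    ⁅hT A lam J W i', zT A lam J W i s⁆ =
      (s.map (fun j : J => (A i' j : ℂ))).sum • zT A lam J W i s := by
  induction s using Multiset.induction with
  | empty => rw [zT_zero]; simp [hT_h]
  | cons j s ih =>
    rw [zT_cons, leibniz_lie, ih, hT_d, smul_lie, lie_smul, ← add_smul, Multiset.map_cons,
      Multiset.sum_cons]

theorem model_brep (hsym : ∀ i j, A i j = A j i) (hz : ∀ i j, A i j = 0 ↔ i ∈ J ∧ j ∈ J) :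
    BRep A (eT J W) (fT A lam J W) (hT A lam J W) where
  hh := hT_h A lam J W
  he i j := by
    unfold eT
    split_ifs with hj
    · exact hT_d A lam J W i ⟨j, hj⟩
    · rw [hT_L]; simp [wtX, bext, -Complex.coe_smul]
  hf i j := by
    unfold fT
    split_ifs with hj
    · exact hT_g A lam J W hsym i ⟨j, hj⟩
    · refine W.ext _ (by exact W.P.lie_mem (W.Op_mem _) (W.Op_mem _)) _ ?_ fun x => ?_
      · exact W.P.neg_mem (W.P.smul_mem _ (W.Op_mem _))
      · rw [lie_lie, W.Op_lie, hT_L, lie_smul, neg_lie, smul_lie, W.Op_lie]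
        obtain ⟨s, k⟩ := x
        by_cases hk : k = some j
        · subst hk
          simp only [if_true]
          rw [hT_z, ← sub_smul, ← neg_smul]
          congr 1
          simp only [wtX, bext, Option.elim]
          ring
        · simp [hk]
  ef i j := by
    unfold eT fT
    by_cases hi : i ∈ J <;> by_cases hj : j ∈ J
    · simp only [hi, hj, dif_pos]
      exact dg A lam J W hz ⟨i, hi⟩ ⟨j, hj⟩
    · have hij : ¬ i = j := by rintro rfl; exact hj hi
      simp only [hi, hj, dif_pos, dif_neg, not_false_iff, if_neg hij]
      refine W.ext _ (by exact W.P.lie_mem (W.Op_mem _) (W.Op_mem _)) _ W.P.zero_mem fun x => ?_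
      rw [lie_lie, W.Op_lie, dT_L, W.Op_lie, zero_lie]
      obtain ⟨s, k⟩ := x
      by_cases hk : k = some j
      · simp only [hk, if_true, zT_cons, sub_self]
      · simp [hk]
    · have hij : ¬ i = j := by rintro rfl; exact hi hj
      simp only [hi, hj, dif_pos, dif_neg, not_false_iff, if_neg hij]
      rw [← lie_skew, gT_L]
      simp
    · simp only [hi, hj, dif_neg, not_false_iff]
      rw [← lie_skew, W.Op_lie]
      by_cases hij : i = j
      · subst hij; simp [zT_zero]
      · simp [hij]
  ee i j h0 := by
    obtain ⟨hi, hj⟩ := (hz i j).1 h0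
    simp only [eT, hi, hj, dif_pos]
    exact dd J W _ _
  ff i j h0 := by
    obtain ⟨hi, hj⟩ := (hz i j).1 h0
    simp only [fT, hi, hj, dif_pos]
    exact gg A lam J W _ _

theorem model_emL (l : List J) (i : K) (hi : i ∉ J) :
    emL (fun j : J => eT J W j) l (eT J W i) = W.Lx ((l : Multiset J), some i) := by
  induction l with
  | nil => simp [eT, hi]
  | cons j l ih =>
    rw [emL_cons, ih]
    have : eT J W (j : K) = dT J W j := by simp [eT]
    rw [this, dT_L]
    rfl

end Model
section ConcreteModel

attribute [local instance] LieRing.ofAssociativeRing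
attribute [-instance] LinearMap.instLieRingModule

/-- Word image of the operator `Oop`. -/
noncomputable def Oword {X : Type*} (c : X → Module.End ℂ (List X →₀ ℂ)) :
    List X → (List X →₀ ℂ)
  | [] => 0
  | x :: w => c x (Finsupp.single w 1) + Lop x (Oword c w)

/-- The operator killing the empty word whose commutator with `Lop x` is `c x`. -/
noncomputable def Oop {X : Type*} (c : X → Module.End ℂ (List X →₀ ℂ)) :
    Module.End ℂ (List X →₀ ℂ) :=
  Finsupp.linearCombination ℂ (Oword c)

theorem Oop_nil {X : Type*} (c : X → Module.End ℂ (List X →₀ ℂ)) :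
    Oop c (Finsupp.single [] 1) = 0 := by
  simp [Oop, Oword]

theorem Oop_lie {X : Type*} (c : X → Module.End ℂ (List X →₀ ℂ)) (x : X) :
    ⁅Oop c, Lop x⁆ = c x := by
  rw [Ring.lie_def, sub_eq_iff_eq_add]
  ext w : 2
  simp only [LinearMap.comp_apply, Module.End.mul_apply, LinearMap.add_apply,
    Finsupp.lsingle_apply, Lop_single]
  simp [Oop, Oword]

theorem End_ext {X : Type*} {a b : Module.End ℂ (List X →₀ ℂ)}
    (h0 : a (Finsupp.single [] 1) = b (Finsupp.single [] 1))
    (h1 : ∀ x : X, ⁅a, Lop x⁆ = ⁅b, Lop x⁆) : a = b := by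
  have h2 : ∀ w, a (Finsupp.single w 1) = b (Finsupp.single w 1) := by
    intro w
    induction w with
    | nil => exact h0
    | cons x w ih =>
      have := congrArg (fun z : Module.End ℂ (List X →₀ ℂ) => z (Finsupp.single w 1)) (h1 x)
      simp only [Ring.lie_def, LinearMap.sub_apply, Module.End.mul_apply, Lop_single, ih] at this
      exact sub_left_injective this
  ext w : 2
  simp only [LinearMap.comp_apply, Finsupp.lsingle_apply]
  exact h2 w

theorem lie_nil {X : Type*} {a b : Module.End ℂ (List X →₀ ℂ)}
    (ha : a (Finsupp.single [] 1) = 0) (hb : b (Finsupp.single [] 1) = 0) :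
    ⁅a, b⁆ (Finsupp.single [] 1) = 0 := by
  rw [Ring.lie_def]
  simp [ha, hb]


theorem Lop_nil {X : Type*} (x : X) :
    Lop x (Finsupp.single ([] : List X) (1 : ℂ)) = Finsupp.single [x] 1 := Lop_single _ _

theorem Lop_indep (X : Type*) : LinearIndependent ℂ (fun x : X => Lop x) := by
  have h1 : LinearIndependent ℂ (fun x : X => Finsupp.single [x] (1 : ℂ)) :=
    (Finsupp.linearIndependent_single_one ℂ (List X)).comp (fun x => [x])
      (fun x y h => by simpa using h)
  refine LinearIndependent.of_comp
    (LinearMap.applyₗ (R := ℂ) (M₂ := List X →₀ ℂ) (Finsupp.single ([] : List X) (1 : ℂ))) ?_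
  have h2 : (LinearMap.applyₗ (R := ℂ) (M₂ := List X →₀ ℂ)
      (Finsupp.single ([] : List X) (1 : ℂ)) ∘ fun x : X => Lop x) =
      fun x : X => Finsupp.single [x] (1 : ℂ) := funext fun x => Lop_nil x
  rw [h2]
  exact h1

theorem exists_wordMod (X : Type uu) :
    ∃ (L : Type uu) (_ : LieRing L) (_ : LieAlgebra ℂ L), Nonempty (WordMod X L) := by
  refine ⟨Module.End ℂ (List X →₀ ℂ), inferInstance, inferInstance, ⟨?_⟩⟩
  exact
  { Lx := fun x => Lop x
    Op := Oop
    P :=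
      { LinearMap.ker (LinearMap.applyₗ (R := ℂ) (M₂ := List X →₀ ℂ) (Finsupp.single ([] : List X) (1 : ℂ))) with
        lie_mem' := by
          intro a b ha hb
          exact lie_nil ha hb }
    Op_mem := fun c => Oop_nil c
    Op_lie := Oop_lie
    ext := fun a ha b hb h => End_ext (Eq.trans ha (Eq.symm hb)) h
    indep := Lop_indep X
    dyn := fun g hg => dynkin_inj g hg }

end ConcreteModel

/-! ### Consequences -/

theorem free_of_model {K : Type uu} {J : Set K} {L : Type uu} [LieRing L] [LieAlgebra ℂ L]
    (W : WordMod (Multiset J × Option K) L) {L0 : Type uu} [LieRing L0] [LieAlgebra ℂ L0]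
    (e : K → L0) (hc : ∀ i j : J, ⁅e i, e j⁆ = 0) (U : Set L0)
    (hU : ∀ x ∈ U, ∃ (l : List J) (i : K), i ∉ J ∧ x = emL (fun j : J => e j) l (e i))
    (p : L0 →ₗ⁅ℂ⁆ L) (hp : ∀ i, p (e i) = eT J W i) :
    Function.Injective (FreeLieAlgebra.lift ℂ (fun u : U => (u : L0))) := by
  choose l k hk hx using fun u : U => hU u.1 u.2
  let g : U → Multiset J × Option K := fun u => ((l u : Multiset J), some (k u))
  have hg : Function.Injective g := by
    intro u v huv
    have h1 : (l u : Multiset J) = (l v : Multiset J) := congrArg Prod.fst huv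
    have h2 : k u = k v := Option.some_injective _ (congrArg Prod.snd huv)
    apply Subtype.ext
    rw [hx u, hx v, h2]
    exact emL_perm _ hc (Multiset.coe_eq_coe.1 h1) _
  have hemL : ∀ (l : List J) (y : L0),
      p (emL (fun j : J => e j) l y) = emL (fun j : J => eT J W j) l (p y) := by
    intro l y
    induction l with
    | nil => rfl
    | cons j l ih => rw [emL_cons, emL_cons, LieHom.map_lie, ih, hp]
  have hcomp : p.comp (FreeLieAlgebra.lift ℂ (fun u : U => (u : L0))) =
      FreeLieAlgebra.lift ℂ (fun u => W.Lx (g u)) := by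
    refine FreeLieAlgebra.hom_ext ?_
    intro u
    rw [LieHom.comp_apply, FreeLieAlgebra.lift_of_apply, FreeLieAlgebra.lift_of_apply, hx u, hemL,
      hp, model_emL J W _ _ (hk u)]
  have hinj := W.dyn g hg
  rw [← hcomp] at hinj
  intro x y hxy
  apply hinj
  rw [LieHom.comp_apply, LieHom.comp_apply, hxy]

theorem range_lift {L0 : Type*} [LieRing L0] [LieAlgebra ℂ L0] (U : Set L0) :
    (FreeLieAlgebra.lift ℂ (fun u : U => (u : L0))).range = LieSubalgebra.lieSpan ℂ L0 U := by
  apply le_antisymm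
  · rintro x hx
    obtain ⟨y, rfl⟩ := (LieHom.mem_range _ _).1 hx
    let q : FreeLieAlgebra ℂ U →ₗ⁅ℂ⁆ LieSubalgebra.lieSpan ℂ L0 U :=
      FreeLieAlgebra.lift ℂ (fun u : U => ⟨u, LieSubalgebra.subset_lieSpan u.2⟩)
    have hq : (LieSubalgebra.lieSpan ℂ L0 U).incl.comp q =
        FreeLieAlgebra.lift ℂ (fun u : U => (u : L0)) := by
      refine FreeLieAlgebra.hom_ext ?_
      intro u
      simp [q]
    rw [← hq]
    exact (q y).2
  · refine LieSubalgebra.lieSpan_le.2 ?_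
    intro u hu
    exact (LieHom.mem_range _ _).2 ⟨of ℂ (⟨u, hu⟩ : U), FreeLieAlgebra.lift_of_apply _ _⟩

/-- A subspace grading separating the three summands. -/
theorem indep_three {K : Type*} {A : K → K → ℝ} (hd : ∀ i, A i i ≤ 0) (J : Set K) :
    iSupIndep ![(LieSubalgebra.lieSpan ℂ (BorcherdsAlgebra A) (USet (gF A) J)).toSubmodule,
      midM (gE A) (gF A) (gH A) J,
      (LieSubalgebra.lieSpan ℂ (BorcherdsAlgebra A) (USet (gE A) J)).toSubmodule] := by
  have r := brep_gen A
  let c : K → ℂ := fun i => if i ∈ J then 1 else 2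
  have hc : ∀ i, c i ≠ 0 := fun i => by
    simp only [c]; split_ifs <;> norm_num
  have r2 : BRep A (fun i => c i • gE A i) (fun i => (c i)⁻¹ • gF A i) (gH A) :=
    { hh := r.hh
      he := fun i j => by rw [lie_smul, r.he, smul_comm]
      hf := fun i j => by rw [lie_smul, r.hf, smul_neg, smul_comm]
      ef := fun i j => by
        rw [lie_smul, smul_lie, r.ef]
        by_cases hij : i = j
        · subst hij
          rw [if_pos rfl, smul_smul, inv_mul_cancel₀ (hc i), one_smul]
        · rw [if_neg hij, smul_zero, smul_zero]
      ee := fun i j h0 => by rw [lie_smul, smul_lie, r.ee i j h0, smul_zero, smul_zero]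
      ff := fun i j h0 => by rw [lie_smul, smul_lie, r.ff i j h0, smul_zero, smul_zero] }
  obtain ⟨φ, hE, hF, hH⟩ := brep_lift hd r2
  let V : ℤ → Submodule ℂ (BorcherdsAlgebra A) := fun n =>
    Module.End.eigenspace (φ : BorcherdsAlgebra A →ₗ[ℂ] BorcherdsAlgebra A) ((2 : ℂ) ^ n)
  have mV : ∀ n x, x ∈ V n ↔ φ x = (2 : ℂ) ^ n • x := fun n x => Module.End.mem_eigenspace_iff
  have hV : ∀ n m x y, x ∈ V n → y ∈ V m → ⁅x, y⁆ ∈ V (n + m) := by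
    intro n m x y hx hy
    rw [mV] at hx hy ⊢
    rw [LieHom.map_lie, hx, hy, lie_smul, smul_lie, smul_smul, zpow_add₀ (by norm_num), mul_comm]
  have hV' : ∀ n m x y, x ∈ V (-n) → y ∈ V (-m) → ⁅x, y⁆ ∈ V (-(n + m)) := by
    intro n m x y hx hy
    rw [neg_add]
    exact hV _ _ _ _ hx hy
  have hEJ : ∀ j : J, gE A j ∈ V 0 := fun j => by rw [mV, hE]; simp [c]
  have hFJ : ∀ j : J, gF A j ∈ V 0 := fun j => by rw [mV, hF]; simp [c]
  have hH0 : ∀ i, gH A i ∈ V 0 := fun i => by rw [mV, hH]; simp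
  have hEn : ∀ i, i ∉ J → gE A i ∈ V 1 := fun i hi => by rw [mV, hE]; simp [c, hi]
  have hFn : ∀ i, i ∉ J → gF A i ∈ V (-1) := fun i hi => by rw [mV, hF]; simp [c, hi]
  have hP : (LieSubalgebra.lieSpan ℂ (BorcherdsAlgebra A) (USet (gE A) J)).toSubmodule ≤
      ⨆ n ∈ {n : ℤ | 0 < n}, V n := by
    have : LieSubalgebra.lieSpan ℂ (BorcherdsAlgebra A) (USet (gE A) J) ≤ posPart V hV := by
      refine LieSubalgebra.lieSpan_le.2 ?_
      rintro x ⟨l, i, hi, rfl⟩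
      refine mem_posPart V hV 1 one_pos _ ?_
      induction l with
      | nil => exact hEn i hi
      | cons j l ih =>
        have := hV _ _ _ _ (hEJ j) ih
        rwa [zero_add] at this
    exact this
  have hQ : (LieSubalgebra.lieSpan ℂ (BorcherdsAlgebra A) (USet (gF A) J)).toSubmodule ≤
      ⨆ n ∈ {n : ℤ | n < 0}, V n := by
    have : LieSubalgebra.lieSpan ℂ (BorcherdsAlgebra A) (USet (gF A) J) ≤
        posPart (fun n => V (-n)) hV' := by
      refine LieSubalgebra.lieSpan_le.2 ?_
      rintro x ⟨l, i, hi, rfl⟩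
      refine mem_posPart (fun n => V (-n)) hV' 1 one_pos _ ?_
      induction l with
      | nil => exact hFn i hi
      | cons j l ih =>
        have := hV _ _ _ _ (hFJ j) ih
        rwa [zero_add] at this
    have h2 : (⨆ n ∈ {n : ℤ | 0 < n}, V (-n)) ≤ ⨆ n ∈ {n : ℤ | n < 0}, V n := by
      refine iSup₂_le fun n hn => ?_
      exact le_biSup V (i := -n) (show -n < 0 from neg_neg_of_pos hn)
    exact le_trans (show _ ≤ (⨆ n ∈ {n : ℤ | 0 < n}, V (-n)) from this) h2
  have hM : midM (gE A) (gF A) (gH A) J ≤ ⨆ n ∈ ({0} : Set ℤ), V n := by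
    refine le_trans (Submodule.span_le.2 ?_) (le_biSup V (i := 0) rfl)
    rintro x ((⟨j, hj, rfl⟩ | ⟨j, hj, rfl⟩) | ⟨i, rfl⟩)
    · exact hEJ ⟨j, hj⟩
    · exact hFJ ⟨j, hj⟩
    · exact hH0 i
  have key : iSupIndep V := by
    refine (Module.End.eigenspaces_iSupIndep
      (φ : BorcherdsAlgebra A →ₗ[ℂ] BorcherdsAlgebra A)).comp (f := fun n : ℤ => (2 : ℂ) ^ n) ?_
    intro n m hnm
    have h2 : ((2 : ℝ) ^ n) = (2 : ℝ) ^ m := by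
      have : (((2 : ℝ) ^ n : ℝ) : ℂ) = (((2 : ℝ) ^ m : ℝ) : ℂ) := by
        push_cast; exact hnm
      exact_mod_cast this
    exact zpow_right_injective₀ (by norm_num) (by norm_num) h2
  have d : ∀ s t u : Set ℤ, Disjoint s (t ∪ u) →
      Disjoint (⨆ n ∈ s, V n) ((⨆ n ∈ t, V n) ⊔ ⨆ n ∈ u, V n) := by
    intro s t u h
    rw [← iSup_union]
    exact key.disjoint_biSup_biSup h
  have e1 : Disjoint {n : ℤ | n < 0} (({0} : Set ℤ) ∪ {n : ℤ | 0 < n}) := by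
    rw [Set.disjoint_left]; intro a ha hb
    simp at ha hb; omega
  have e2 : Disjoint ({0} : Set ℤ) ({n : ℤ | 0 < n} ∪ {n : ℤ | n < 0}) := by
    rw [Set.disjoint_left]; intro a ha hb
    simp at ha hb; omega
  have e3 : Disjoint {n : ℤ | 0 < n} ({n : ℤ | n < 0} ∪ ({0} : Set ℤ)) := by
    rw [Set.disjoint_left]; intro a ha hb
    simp at ha hb; omega
  rw [iSupIndep_fin_three]
  exact ⟨(d _ _ _ e1).mono hQ (sup_le_sup hM hP), (d _ _ _ e2).mono hM (sup_le_sup hP hQ),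
    (d _ _ _ e3).mono hP (sup_le_sup hQ hM)⟩

theorem coef_zero {K : Type uu} {J : Set K} {L : Type uu} [LieRing L] [LieAlgebra ℂ L]
    (W : WordMod (Multiset J × Option K) L) {M : Type*} [AddCommGroup M] [Module ℂ M]
    (E F H : J → M) (m : J → ℂ) (T : M →ₗ[ℂ] L)
    (hE : ∀ j, T (E j) = W.Lx ({j}, none)) (hF : ∀ j, T (F j) = 0)
    (hH : ∀ j, T (H j) = m j • W.Lx (0, none)) (a b c : J →₀ ℂ)
    (h0 : T (Finsupp.linearCombination ℂ E a + Finsupp.linearCombination ℂ F b +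
      Finsupp.linearCombination ℂ H c) = 0) :
    a = 0 ∧ Finsupp.linearCombination ℂ m c = 0 := by
  let g : J → Multiset J × Option K := fun j => ({j}, none)
  have hg : Function.Injective g := fun i j h => by simpa [g] using h
  set t := Finsupp.linearCombination ℂ m c with ht
  have h1 : Finsupp.linearCombination ℂ W.Lx
      (a.mapDomain g + Finsupp.single (0, none) t) = 0 := by
    rw [map_add, Finsupp.linearCombination_mapDomain, Finsupp.linearCombination_single]
    rw [map_add, map_add, Finsupp.apply_linearCombination, Finsupp.apply_linearCombination,
      Finsupp.apply_linearCombination] at h0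
    have i1 : (T ∘ E) = W.Lx ∘ g := funext hE
    have i2 : (T ∘ F) = 0 := funext hF
    have i3 : Finsupp.linearCombination ℂ (T ∘ H) c = t • W.Lx (0, none) := by
      rw [ht, Finsupp.linearCombination_apply, Finsupp.linearCombination_apply, Finsupp.sum,
        Finsupp.sum, Finset.sum_smul]
      refine Finset.sum_congr rfl fun j _ => ?_
      rw [Function.comp_apply, hH, smul_smul, smul_eq_mul]
    rw [i1, i2, i3] at h0
    simpa using h0
  have h2 := (linearIndependent_iff.1 W.indep) _ h1
  have hn : ∀ j, g j ≠ (0, none) := fun j h => by simp [g] at h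
  constructor
  · ext j
    have := DFunLike.congr_fun h2 (g j)
    rw [Finsupp.add_apply, Finsupp.mapDomain_apply hg, Finsupp.single_eq_of_ne (hn j)] at this
    simpa using this
  · have := DFunLike.congr_fun h2 ((0 : Multiset J), (none : Option K))
    rw [Finsupp.add_apply, Finsupp.mapDomain_of_notMem_range _ _ (fun ⟨j, hj⟩ => hn j hj),
      Finsupp.single_eq_same] at this
    simpa using this

theorem gJ_iso {K : Type uu} {A : K → K → ℝ} (hsym : ∀ i j, A i j = A j i)
    (hd : ∀ i, A i i ≤ 0) (J : Set K) (hz : ∀ i j, A i j = 0 ↔ i ∈ J ∧ j ∈ J) :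
    Nonempty ((BorcherdsAlgebra (fun i j : ↥J => A i j)) ≃ₗ⁅ℂ⁆
      ↥(LieSubalgebra.lieSpan ℂ (BorcherdsAlgebra A)
        {x | ∃ j ∈ J, x = gE A j ∨ x = gF A j ∨ x = gH A j})) := by
  have r := brep_gen A
  set B : J → J → ℝ := fun i j => A i j with hB
  have rJ : BRep B (fun j : J => gE A j) (fun j : J => gF A j) (fun j : J => gH A j) :=
    { hh := fun i j => r.hh i j
      he := fun i j => r.he i j
      hf := fun i j => r.hf i j
      ef := fun i j => by
        rw [r.ef]
        simp only [Subtype.ext_iff]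
      ee := fun i j h0 => r.ee i j h0
      ff := fun i j h0 => r.ff i j h0 }
  obtain ⟨ψ, hE, hF, hH⟩ := brep_lift (A := B) (fun i => hd i) rJ
  -- spanning of the source
  have htop : midM (gE B) (gF B) (gH B) Set.univ = ⊤ := by
    have h1 := span_top (A := B) (J := Set.univ)
      (fun i j => ⟨fun _ => ⟨trivial, trivial⟩, fun _ => (hz i j).2 ⟨i.2, j.2⟩⟩)
    have hU : ∀ e : J → BorcherdsAlgebra B, USet e Set.univ = ∅ := by
      intro e
      ext x
      simp [USet]
    rw [hU, hU] at h1
    simpa using h1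
  have hrep : ∀ x : BorcherdsAlgebra B, ∃ a b c : J →₀ ℂ,
      x = Finsupp.linearCombination ℂ (gE B) a + Finsupp.linearCombination ℂ (gF B) b +
        Finsupp.linearCombination ℂ (gH B) c := by
    intro x
    have hx : x ∈ midM (gE B) (gF B) (gH B) Set.univ := htop ▸ Submodule.mem_top
    rw [midM, Set.image_univ, Set.image_univ, Submodule.span_union, Submodule.span_union] at hx
    obtain ⟨y, hy, z, hz, rfl⟩ := Submodule.mem_sup.1 hx
    obtain ⟨u, hu, v, hv, rfl⟩ := Submodule.mem_sup.1 hy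
    obtain ⟨a, rfl⟩ := (Finsupp.mem_span_range_iff_exists_finsupp).1 hu
    obtain ⟨b, rfl⟩ := (Finsupp.mem_span_range_iff_exists_finsupp).1 hv
    obtain ⟨c, rfl⟩ := (Finsupp.mem_span_range_iff_exists_finsupp).1 hz
    exact ⟨a, b, c, rfl⟩
  have hrange : ψ.range = LieSubalgebra.lieSpan ℂ (BorcherdsAlgebra A)
      {x | ∃ j ∈ J, x = gE A j ∨ x = gF A j ∨ x = gH A j} := by
    apply le_antisymm
    · intro y hy
      obtain ⟨x, rfl⟩ := (LieHom.mem_range _ _).1 hy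
      have hx : x ∈ midM (gE B) (gF B) (gH B) Set.univ := htop ▸ Submodule.mem_top
      have hle : midM (gE B) (gF B) (gH B) Set.univ ≤
          (LieSubalgebra.lieSpan ℂ (BorcherdsAlgebra A)
            {x | ∃ j ∈ J, x = gE A j ∨ x = gF A j ∨ x = gH A j}).toSubmodule.comap
            (ψ : BorcherdsAlgebra B →ₗ[ℂ] BorcherdsAlgebra A) := by
        refine Submodule.span_le.2 ?_
        rintro x ((⟨j, -, rfl⟩ | ⟨j, -, rfl⟩) | ⟨j, rfl⟩)
        · change ψ (gE B j) ∈ LieSubalgebra.lieSpan ℂ (BorcherdsAlgebra A) _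
          rw [hE]; exact LieSubalgebra.subset_lieSpan ⟨j, j.2, Or.inl rfl⟩
        · change ψ (gF B j) ∈ LieSubalgebra.lieSpan ℂ (BorcherdsAlgebra A) _
          rw [hF]; exact LieSubalgebra.subset_lieSpan ⟨j, j.2, Or.inr (Or.inl rfl)⟩
        · change ψ (gH B j) ∈ LieSubalgebra.lieSpan ℂ (BorcherdsAlgebra A) _
          rw [hH]; exact LieSubalgebra.subset_lieSpan ⟨j, j.2, Or.inr (Or.inr rfl)⟩
      exact hle hx
    · refine LieSubalgebra.lieSpan_le.2 ?_
      rintro x ⟨j, hj, rfl | rfl | rfl⟩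
      · exact (LieHom.mem_range _ _).2 ⟨_, hE ⟨j, hj⟩⟩
      · exact (LieHom.mem_range _ _).2 ⟨_, hF ⟨j, hj⟩⟩
      · exact (LieHom.mem_range _ _).2 ⟨_, hH ⟨j, hj⟩⟩
  have hinj : Function.Injective ψ := by
    rw [injective_iff_map_eq_zero]
    intro x hx
    obtain ⟨a, b, c, rfl⟩ := hrep x
    obtain ⟨L, iL, iA, ⟨W⟩⟩ := exists_wordMod (Multiset J × Option K)
    have hfin : ∀ p : BorcherdsAlgebra A →ₗ⁅ℂ⁆ L, ∃ T : BorcherdsAlgebra B →ₗ[ℂ] L,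
        (∀ y, T y = ⁅p (ψ y), W.Lx (0, none)⁆) := by
      intro p
      exact ⟨{ toFun := fun y => ⁅p (ψ y), W.Lx (0, none)⁆
               map_add' := fun y z => by rw [map_add, map_add, add_lie]
               map_smul' := fun s y => by rw [map_smul, map_smul, smul_lie, RingHom.id_apply] },
        fun y => rfl⟩
    have eJ : ∀ j : J, ⁅eT J W (j : K), W.Lx (0, none)⁆ = W.Lx ({j}, none) := fun j => by
      have : eT J W (j : K) = dT J W j := by simp [eT]
      rw [this, dT_L]; rfl
    have fJ : ∀ lam, ∀ j : J, ⁅fT A lam J W (j : K), W.Lx (0, none)⁆ = 0 := fun lam j => by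
      have : fT A lam J W (j : K) = gT A lam J W j := by simp [fT]
      rw [this, gT_L]; simp
    have hJ : ∀ lam, ∀ j : J, ⁅hT A lam J W (j : K), W.Lx (0, none)⁆ =
        lam j • W.Lx (0, none) := fun lam j => by
      rw [hT_L]; simp [wtX, bext]
    have hac : ∀ lam : K → ℂ, a = 0 ∧ Finsupp.linearCombination ℂ (fun j : J => lam j) c = 0 := by
      intro lam
      obtain ⟨p, pE, pF, pH⟩ := brep_lift hd (model_brep A lam J W hsym hz)
      obtain ⟨T, hT⟩ := hfin p
      refine coef_zero W (gE B) (gF B) (gH B) (fun j : J => lam j) T ?_ ?_ ?_ a b c ?_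
      · intro j; rw [hT, hE, pE, eJ]
      · intro j; rw [hT, hF, pF, fJ]
      · intro j; rw [hT, hH, pH, hJ]
      · rw [hT, hx, map_zero, zero_lie]
    have hb : b = 0 := by
      obtain ⟨p, pE, pF, pH⟩ := brep_lift hd (model_brep A 0 J W hsym hz).swap
      obtain ⟨T, hT⟩ := hfin p
      refine (coef_zero W (gF B) (gE B) (gH B) (fun j : J => 0) T ?_ ?_ ?_ b a c ?_).1
      · intro j; rw [hT, hF, pF, eJ]
      · intro j; rw [hT, hE, pE, fJ]
      · intro j; rw [hT, hH, pH, neg_lie, hJ]; simp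
      · rw [add_comm (Finsupp.linearCombination ℂ (gF B) b), hT, hx, map_zero, zero_lie]
    have hcz : c = 0 := by
      ext j
      have := (hac (fun i => if i = j then 1 else 0)).2
      rw [Finsupp.linearCombination_apply, Finsupp.sum] at this
      simpa [← Subtype.ext_iff] using this
    rw [(hac 0).1, hb, hcz]
    simp
  exact ⟨(LieEquiv.ofInjective ψ hinj).trans (LieEquiv.ofEq _ _ (congrArg _ hrange))⟩
/-- Decomposition of a Borcherds algebra whose Cartan matrix has all diagonal
entries `≤ 0` and whose zeroes form a single diagonal block indexed by
`J = {j : a_{jj} = 0}`: the subalgebras generated by `U⁺` and `U⁻` are free, the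
whole algebra is the vector space direct sum `𝔲⁻ ⊕ (𝔤_J + 𝔥) ⊕ 𝔲⁺`, and `𝔤_J` is
(isomorphic to) the Borcherds algebra of the submatrix `(a_{ij})_{i,j ∈ J}`. -/
theorem borcherds_decomposition (A : I → I → ℝ)
    (hsym : ∀ i j, A i j = A j i)
    (hoff : ∀ i j, i ≠ j → A i j ≤ 0)
    (hdiag : ∀ i, A i i ≤ 0)
    (J : Set I) (hJ : J = {j | A j j = 0})
    (hzero : ∀ i j, A i j = 0 ↔ i ∈ J ∧ j ∈ J) :
    Function.Injective
      (FreeLieAlgebra.lift ℂ (fun u : ↥(Uplus A J) => (u : BorcherdsAlgebra A))) ∧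
    Function.Injective
      (FreeLieAlgebra.lift ℂ (fun u : ↥(Uminus A J) => (u : BorcherdsAlgebra A))) ∧
    DirectSum.IsInternal
      ![(FreeLieAlgebra.lift ℂ
           (fun u : ↥(Uminus A J) => (u : BorcherdsAlgebra A))).range.toSubmodule,
        (LieSubalgebra.lieSpan ℂ (BorcherdsAlgebra A) (gJgens A J)).toSubmodule ⊔
          Submodule.span ℂ (Set.range (gH A)),
        (FreeLieAlgebra.lift ℂ
           (fun u : ↥(Uplus A J) => (u : BorcherdsAlgebra A))).range.toSubmodule] ∧
    Nonempty
      ((BorcherdsAlgebra (fun i j : ↥J => A i j)) ≃ₗ⁅ℂ⁆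
        ↥(LieSubalgebra.lieSpan ℂ (BorcherdsAlgebra A) (gJgens A J))) := by
  have r := brep_gen A
  have hcE : ∀ i j : J, ⁅gE A (i : I), gE A (j : I)⁆ = 0 := fun i j =>
    r.ee i j ((hzero i j).2 ⟨i.2, j.2⟩)
  have hcF : ∀ i j : J, ⁅gF A (i : I), gF A (j : I)⁆ = 0 := fun i j =>
    r.ff i j ((hzero i j).2 ⟨i.2, j.2⟩)
  have hUp : Uplus A J = USet (gE A) J := Set.ext fun x => Ugen_iff (gE A) J hcE x
  have hUm : Uminus A J = USet (gF A) J := Set.ext fun x => Ugen_iff (gF A) J hcF x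
  obtain ⟨L, iL, iA, ⟨W⟩⟩ := exists_wordMod (Multiset J × Option I)
  have hmid := lieSpan_gens_le_mid hzero r
  refine ⟨?_, ?_, ?_, gJ_iso hsym hdiag J hzero⟩
  · obtain ⟨p, pE, -, -⟩ := brep_lift hdiag (model_brep A 0 J W hsym hzero)
    exact free_of_model W (gE A) hcE _ (fun x hx => (Ugen_iff (gE A) J hcE x).1 hx) p pE
  · obtain ⟨p, -, pF, -⟩ := brep_lift hdiag (model_brep A 0 J W hsym hzero).swap
    exact free_of_model W (gF A) hcF _ (fun x hx => (Ugen_iff (gF A) J hcF x).1 hx) p pF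
  · rw [range_lift, range_lift, hUp, hUm]
    change DirectSum.IsInternal ![_, (LieSubalgebra.lieSpan ℂ (BorcherdsAlgebra A)
      {x | ∃ j ∈ J, x = gE A j ∨ x = gF A j ∨ x = gH A j}).toSubmodule ⊔
          Submodule.span ℂ (Set.range (gH A)), _]
    rw [hmid, DirectSum.isInternal_submodule_iff_iSupIndep_and_iSup_eq_top]
    refine ⟨indep_three hdiag J, ?_⟩
    rw [eq_top_iff, ← span_top hzero]
    exact sup_le (le_iSup_of_le 0 le_rfl) (sup_le (le_iSup_of_le 1 le_rfl) (le_iSup_of_le 2 le_rfl))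

end Stmt4
end

section
/- In a Borcherds algebra 𝔤(A) with all diagonal entries a_{ii} ≤ 0, J = {j : a_{jj} = 0}, and a_{ij} = 0 iff i, j ∈ J, the set of positive roots (with respect to the extended Cartan subalgebra) equals the union of {α_j : j ∈ J} and {α_{j₁}+⋯+α_{jₙ}+α_{i₁}+⋯+α_{i_p} : n ≥ 0, p > 0, j_k ∈ J, i_k ∈ I∖J} minus the set {tα_i : t ≥ 2, i ∈ I∖J}. -/
open scoped Classical
open FreeLieAlgebra

section AbstractPart

variable {I : Type*} {L : Type*} [LieRing L] [LieAlgebra ℂ L]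

/-- Right-normed bracket of a list of letters. -/
noncomputable def rnb (e : I → L) : I → List I → L
  | i, [] => e i
  | i, j :: w => ⁅e i, rnb e j w⁆

/-- Weight of a word. -/
noncomputable def wtw : List I → (I →₀ ℤ)
  | [] => 0
  | i :: w => Finsupp.single i 1 + wtw w

lemma wtw_nonneg (w : List I) (l : I) : 0 ≤ wtw w l := by
  induction w with
  | nil => simp [wtw]
  | cons a w ih =>
    simp only [wtw, Finsupp.add_apply, Finsupp.single_apply]
    split_ifs <;> omega

lemma wtw_pos (w : List I) (l : I) (h : l ∈ w) : 0 < wtw w l := by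
  induction w with
  | nil => simp at h
  | cons a w ih =>
    have := wtw_nonneg w l
    simp only [wtw, Finsupp.add_apply, Finsupp.single_apply]
    rcases List.mem_cons.1 h with h | h
    · simp [h]; subst h; omega
    · have := ih h
      split_ifs <;> omega

lemma rnb_mem (e : I → L) (G : (I →₀ ℤ) → Submodule ℂ L) (s : ℤ)
    (hbr : ∀ c c' x y, x ∈ G c → y ∈ G c' → ⁅x, y⁆ ∈ G (c + c'))
    (he : ∀ i, e i ∈ G (s • Finsupp.single i 1)) (i : I) (w : List I) :
    rnb e i w ∈ G (s • wtw (i :: w)) := by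
  induction w generalizing i with
  | nil => simpa [rnb, wtw] using he i
  | cons j w ih =>
    have := hbr _ _ _ _ (he i) (ih j)
    rw [← smul_add] at this
    exact this

lemma rnb_zero (e : I → L) (i j : I) (w : List I)
    (h : ∀ a ∈ i :: j :: w, ∀ b ∈ i :: j :: w, ⁅e a, e b⁆ = 0) : rnb e i (j :: w) = 0 := by
  induction w generalizing i j with
  | nil => exact h i (by simp) j (by simp)
  | cons k w ih =>
    have : rnb e j (k :: w) = 0 := ih j k (fun a ha b hb => h a (by simp_all) b (by simp_all))
    simp only [rnb] at this ⊢
    rw [this, lie_zero]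

lemma rnb_h (e : I → L) (h : L) (b : I → ℂ) (H : ∀ j, ⁅h, e j⁆ = b j • e j) (i : I) (w : List I) :
    ∃ t : ℂ, ⁅h, rnb e i w⁆ = t • rnb e i w := by
  induction w generalizing i with
  | nil => exact ⟨b i, H i⟩
  | cons j w ih =>
    obtain ⟨t, ht⟩ := ih j
    refine ⟨b i + t, ?_⟩
    simp only [rnb]
    rw [leibniz_lie, H, ht]
    simp [add_smul]

/-- Acting by an opposite generator keeps us in the span of words and the Cartan part. -/
lemma rnb_opp (e h : I → L) (f : L) (i₀ : I) (T : Submodule ℂ L) (b : I → I → ℂ) (s : ℂ)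
    (H : ∀ i j, ⁅h i, e j⁆ = b i j • e j)
    (hf : ∀ j, ⁅f, e j⁆ = if i₀ = j then s • h j else 0)
    (hT : ∀ i w, rnb e i w ∈ T) (hTh : ∀ i, h i ∈ T) (i : I) (w : List I) :
    ⁅f, rnb e i w⁆ ∈ T ∧ ∀ k, ⁅e k, ⁅f, rnb e i w⁆⁆ ∈ T := by
  -- strengthen: the bracket lies in the span of words and Cartan elements
  have key : ∀ (w : List I) (i : I), ⁅f, rnb e i w⁆ ∈
      Submodule.span ℂ ({x | ∃ i w, x = rnb e i w} ∪ Set.range h) := by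
    intro w
    induction w with
    | nil =>
      intro i
      simp only [rnb, hf]
      split_ifs
      · exact Submodule.smul_mem _ _ (Submodule.subset_span (Or.inr ⟨i, rfl⟩))
      · exact zero_mem _
    | cons j w ih =>
      intro i
      simp only [rnb]
      rw [leibniz_lie, hf]
      refine add_mem ?_ ?_
      · split_ifs
        · obtain ⟨t, ht⟩ := rnb_h e (h i) (b i) (H i) j w
          rw [smul_lie, ht]
          exact Submodule.smul_mem _ _ (Submodule.smul_mem _ _
            (Submodule.subset_span (Or.inl ⟨j, w, rfl⟩)))
        · simp
      · have := ih j
        refine Submodule.span_induction (p := fun x _ => ⁅e i, x⁆ ∈ _) ?_ ?_ ?_ ?_ this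
        · rintro x (⟨k, v, rfl⟩ | ⟨k, rfl⟩)
          · exact Submodule.subset_span (Or.inl ⟨i, k :: v, rfl⟩)
          · rw [← lie_skew, H]
            exact neg_mem (Submodule.smul_mem _ _ (Submodule.subset_span (Or.inl ⟨i, [], rfl⟩)))
        · simp
        · intro x y _ _ hx hy
          rw [lie_add]; exact add_mem hx hy
        · intro a x _ hx
          rw [lie_smul]; exact Submodule.smul_mem _ _ hx
  constructor
  · refine (Submodule.span_le.2 ?_) (key w i)
    rintro x (⟨k, v, rfl⟩ | ⟨k, rfl⟩)
    · exact hT _ _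
    · exact hTh _
  · intro k
    refine Submodule.span_induction (p := fun x _ => ⁅e k, x⁆ ∈ T) ?_ ?_ ?_ ?_ (key w i)
    · rintro x (⟨l, v, rfl⟩ | ⟨l, rfl⟩)
      · exact hT k (l :: v)
      · rw [← lie_skew, H]
        exact neg_mem (Submodule.smul_mem _ _ (hT k []))
    · simp
    · intro x y _ _ hx hy
      rw [lie_add]; exact add_mem hx hy
    · intro a x _ hx
      rw [lie_smul]; exact Submodule.smul_mem _ _ hx

/-- If `L` is generated by `e,f,h`, it is spanned by the words in `e`, words in `f`, and `h`. -/
lemma span_top_s5 (A : I → I → ℂ) (e f h : I → L)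
    (gen : ∀ S : LieSubalgebra ℂ L, (∀ i, e i ∈ S) → (∀ i, f i ∈ S) → (∀ i, h i ∈ S) → S = ⊤)
    (hh : ∀ i j, ⁅h i, h j⁆ = 0) (he : ∀ i j, ⁅h i, e j⁆ = A i j • e j)
    (hf : ∀ i j, ⁅h i, f j⁆ = (-A i j) • f j)
    (ef : ∀ i j, ⁅e i, f j⁆ = if i = j then h i else 0) :
    Submodule.span ℂ ({x | ∃ i w, x = rnb e i w} ∪ {x | ∃ i w, x = rnb f i w} ∪ Set.range h)
      = ⊤ := by
  set T := Submodule.span ℂ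
    ({x | ∃ i w, x = rnb e i w} ∪ {x | ∃ i w, x = rnb f i w} ∪ Set.range h) with hTdef
  have hTe : ∀ i w, rnb e i w ∈ T := fun i w => Submodule.subset_span (Or.inl (Or.inl ⟨i, w, rfl⟩))
  have hTf : ∀ i w, rnb f i w ∈ T := fun i w => Submodule.subset_span (Or.inl (Or.inr ⟨i, w, rfl⟩))
  have hTh : ∀ i, h i ∈ T := fun i => Submodule.subset_span (Or.inr ⟨i, rfl⟩)
  have clos : ∀ g : L, (∀ i w, ⁅g, rnb e i w⁆ ∈ T) → (∀ i w, ⁅g, rnb f i w⁆ ∈ T) →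
      (∀ i, ⁅g, h i⁆ ∈ T) → ∀ x ∈ T, ⁅g, x⁆ ∈ T := by
    intro g h1 h2 h3 x hx
    refine Submodule.span_induction (p := fun x _ => ⁅g, x⁆ ∈ T) ?_ ?_ ?_ ?_ hx
    · rintro x ((⟨l, v, rfl⟩ | ⟨l, v, rfl⟩) | ⟨l, rfl⟩)
      · exact h1 _ _
      · exact h2 _ _
      · exact h3 _
    · simp
    · intro x y _ _ hx hy
      rw [lie_add]; exact add_mem hx hy
    · intro a x _ hx
      rw [lie_smul]; exact Submodule.smul_mem _ _ hx
  let N : LieSubalgebra ℂ L :=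
    { carrier := {g | ∀ x ∈ T, ⁅g, x⁆ ∈ T}
      add_mem' := by
        intro a b ha hb x hx
        rw [add_lie]; exact add_mem (ha x hx) (hb x hx)
      zero_mem' := by intro x hx; simp
      smul_mem' := by
        intro t a ha x hx
        rw [smul_lie]; exact Submodule.smul_mem _ _ (ha x hx)
      lie_mem' := by
        intro a b ha hb x hx
        rw [lie_lie]; exact sub_mem (ha _ (hb x hx)) (hb _ (ha x hx)) }
  have hN : N = ⊤ := by
    apply gen
    · intro i
      refine clos (e i) (fun j w => hTe i (j :: w)) (fun j w => ?_) (fun j => ?_)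
      · refine (rnb_opp f h (e i) i T (fun i j => -A i j) 1 hf ?_ hTf hTh j w).1
        intro j
        rw [ef]
        split_ifs with hij
        · simp [hij]
        · rfl
      · rw [← lie_skew, he]
        exact neg_mem (Submodule.smul_mem _ _ (hTe i []))
    · intro i
      refine clos (f i) (fun j w => ?_) (fun j w => hTf i (j :: w)) (fun j => ?_)
      · refine (rnb_opp e h (f i) i T A (-1) he ?_ hTe hTh j w).1
        intro j
        rw [← lie_skew, ef]
        by_cases hij : j = i
        · simp [hij]
        · have : ¬ i = j := fun h => hij h.symm
          simp [hij, this]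
      · rw [← lie_skew, hf]
        exact neg_mem (Submodule.smul_mem _ _ (hTf i []))
    · intro i
      refine clos (h i) (fun j w => ?_) (fun j w => ?_) (fun j => ?_)
      · obtain ⟨t, ht⟩ := rnb_h e (h i) (A i) (he i) j w
        rw [ht]; exact Submodule.smul_mem _ _ (hTe _ _)
      · obtain ⟨t, ht⟩ := rnb_h f (h i) (fun j => -A i j) (hf i) j w
        rw [ht]; exact Submodule.smul_mem _ _ (hTf _ _)
      · rw [hh]; exact zero_mem _
  have hN' : ∀ g x : L, x ∈ T → ⁅g, x⁆ ∈ T := by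
    intro g
    have : g ∈ N := by rw [hN]; trivial
    exact this
  let T' : LieSubalgebra ℂ L := { T with lie_mem' := fun {a b} _ hb => hN' a b hb }
  have hT' : T' = ⊤ := gen T' (fun i => hTe i []) (fun i => hTf i []) (fun i => hTh i)
  rw [eq_top_iff]
  intro x _
  have : x ∈ T' := by rw [hT']; trivial
  exact this

/-- One string step. -/
lemma string_step (e f h x : L) (a b : ℝ) (ha : a ≤ 0) (hb : b < 0)
    (he : ⁅h, e⁆ = (a : ℂ) • e) (ef : ⁅e, f⁆ = h) (hx : ⁅h, x⁆ = (b : ℂ) • x)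
    (fx : ⁅f, x⁆ = 0) (x0 : x ≠ 0) (n : ℕ) :
    ((LieAlgebra.ad ℂ L e) ^ n) x ≠ 0 := by
  have hh : ∀ n : ℕ, ⁅h, ((LieAlgebra.ad ℂ L e) ^ n) x⁆
      = ((b : ℂ) + n * a) • ((LieAlgebra.ad ℂ L e) ^ n) x := by
    intro n
    induction n with
    | zero => simp [hx]
    | succ n ih =>
      rw [pow_succ', Module.End.mul_apply, LieAlgebra.ad_apply, leibniz_lie, he, ih, smul_lie,
        lie_smul, ← add_smul]
      congr 1; push_cast; ring
  have hf : ∀ n : ℕ, ⁅f, ((LieAlgebra.ad ℂ L e) ^ (n + 1)) x⁆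
      = (-(((n : ℂ) + 1) * b + n * (n + 1) / 2 * a)) • ((LieAlgebra.ad ℂ L e) ^ n) x := by
    intro n
    have fe : ⁅f, e⁆ = -h := by rw [← lie_skew, ef]
    induction n with
    | zero =>
      simp only [zero_add, pow_one, LieAlgebra.ad_apply, pow_zero, Module.End.one_apply]
      rw [leibniz_lie, fx, fe, neg_lie, hx]
      simp
    | succ n ih =>
      rw [pow_succ', Module.End.mul_apply, LieAlgebra.ad_apply, leibniz_lie, ih, fe, neg_lie, hh,
        lie_smul, ← LieAlgebra.ad_apply (R := ℂ), ← Module.End.mul_apply, ← pow_succ', ← neg_smul,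
        ← add_smul]
      congr 1; push_cast; ring
  induction n with
  | zero => simpa using x0
  | succ n ih =>
    intro h0
    have := hf n
    rw [h0, lie_zero] at this
    rcases smul_eq_zero.1 this.symm with h1 | h1
    · have h2 : (-(((n : ℝ) + 1) * b + n * (n + 1) / 2 * a)) = 0 := by
        apply Complex.ofReal_injective
        push_cast
        exact h1
      have h3 : (n : ℝ) * (n + 1) / 2 * a ≤ 0 := mul_nonpos_of_nonneg_of_nonpos (by positivity) ha
      have h4 : ((n : ℝ) + 1) * b < 0 := mul_neg_of_pos_of_neg (by positivity) hb
      linarith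
    · exact ih h1

/-- Pairing of a weight with a coroot. -/
noncomputable def wtv (A : I → I → ℝ) (l : I) : (I →₀ ℤ) →+ ℝ :=
  Finsupp.liftAddHom (fun m => (AddMonoidHom.mulRight (A l m)).comp (Int.castAddHom ℝ))

lemma wtv_single (A : I → I → ℝ) (l m : I) (t : ℤ) :
    wtv A l (Finsupp.single m t) = t * A l m := by
  simp [wtv]

lemma wtv_neg (A : I → I → ℝ) (hA : ∀ i j, A i j ≤ 0) (l i : I) (hi : A l i ≠ 0)
    (c : I →₀ ℤ) (hc : ∀ k, 0 ≤ c k) (hci : 0 < c i) : wtv A l c < 0 := by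
  have : wtv A l c = c.sum (fun m t => (t : ℝ) * A l m) := by
    simp only [wtv, Finsupp.liftAddHom_apply]
    rfl
  rw [this]
  apply Finset.sum_neg' 
  · intro k _
    exact mul_nonpos_of_nonneg_of_nonpos (by exact_mod_cast hc k) (hA l k)
  · refine ⟨i, by simp [hci.ne'], ?_⟩
    exact mul_neg_of_pos_of_neg (by exact_mod_cast hci) (lt_of_le_of_ne (hA l i) hi)

/-- `x` is a nonzero weight vector of weight `c`. -/
def IsGood (A : I → I → ℝ) (h : I → L) (G : (I →₀ ℤ) → Submodule ℂ L) (c : I →₀ ℤ) (x : L) : Prop :=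
  x ≠ 0 ∧ x ∈ G c ∧ ∀ l, ⁅h l, x⁆ = (wtv A l c : ℂ) • x

lemma good_step (A : I → I → ℝ) (e f h : I → L) (G : (I →₀ ℤ) → Submodule ℂ L)
    (hA : ∀ i j, A i j ≤ 0)
    (hbr : ∀ c c' x y, x ∈ G c → y ∈ G c' → ⁅x, y⁆ ∈ G (c + c'))
    (hE : ∀ i, e i ∈ G (Finsupp.single i 1))
    (he : ∀ i j, ⁅h i, e j⁆ = (A i j : ℂ) • e j)
    (ef : ∀ i j, ⁅e i, f j⁆ = if i = j then h i else 0)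
    (c : I →₀ ℤ) (x : L) (hx : IsGood A h G c x) (k : I) (hk : wtv A k c < 0)
    (fx : ⁅f k, x⁆ = 0) (n : ℕ) :
    IsGood A h G (c + Finsupp.single k (n : ℤ)) (((LieAlgebra.ad ℂ L (e k)) ^ n) x) ∧
    ∀ l, l ≠ k → ⁅f l, x⁆ = 0 → ⁅f l, ((LieAlgebra.ad ℂ L (e k)) ^ n) x⁆ = 0 := by
  refine ⟨⟨?_, ?_, ?_⟩, ?_⟩
  · exact string_step (e k) (f k) (h k) x (A k k) _ (hA k k) hk (he k k) (by simp [ef])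
      (hx.2.2 k) fx hx.1 n
  · induction n with
    | zero => simpa using hx.2.1
    | succ n ih =>
      rw [pow_succ', Module.End.mul_apply, LieAlgebra.ad_apply]
      have := hbr _ _ _ _ (hE k) ih
      convert this using 2
      push_cast
      rw [Finsupp.single_add]; abel
  · intro l
    induction n with
    | zero => simpa using hx.2.2 l
    | succ n ih =>
      rw [pow_succ', Module.End.mul_apply, LieAlgebra.ad_apply, leibniz_lie, he, ih, smul_lie,
        lie_smul, ← add_smul]
      congr 1
      simp only [map_add, wtv_single]
      push_cast; ring
  · intro l hl fl
    induction n with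
    | zero => simpa using fl
    | succ n ih =>
      rw [pow_succ', Module.End.mul_apply, LieAlgebra.ad_apply, leibniz_lie, ih, ← lie_skew (f l) (e k), ef,
        if_neg (Ne.symm hl)]
      simp

lemma good_extend (A : I → I → ℝ) (e f h : I → L) (G : (I →₀ ℤ) → Submodule ℂ L)
    (hA : ∀ i j, A i j ≤ 0)
    (hbr : ∀ c c' x y, x ∈ G c → y ∈ G c' → ⁅x, y⁆ ∈ G (c + c'))
    (hE : ∀ i, e i ∈ G (Finsupp.single i 1))
    (he : ∀ i j, ⁅h i, e j⁆ = (A i j : ℂ) • e j)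
    (ef : ∀ i j, ⁅e i, f j⁆ = if i = j then h i else 0)
    (c : I →₀ ℤ) (x : L) (hx : IsGood A h G c x) (hc : ∀ k, 0 ≤ c k)
    (i : I) (hi : ∀ l, A l i ≠ 0) (hci : 0 < c i) (d : I →₀ ℤ) :
    (∀ k, 0 ≤ d k) → (∀ k, d k ≠ 0 → ⁅f k, x⁆ = 0) →
    ∃ y, IsGood A h G (c + d) y ∧ ∀ l, d l = 0 → ⁅f l, x⁆ = 0 → ⁅f l, y⁆ = 0 := by
  induction d using Finsupp.induction with
  | zero => intro _ _; exact ⟨x, by simpa using hx, fun _ _ h => h⟩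
  | single_add a b d ha hb ih =>
    intro hd hf
    have da : d a = 0 := by simpa using ha
    have hba : 0 ≤ b := by simpa [da] using hd a
    have hd' : ∀ k, 0 ≤ d k := by
      intro k
      by_cases hk : k = a
      · rw [hk, da]
      · have := hd k
        simpa [Finsupp.single_apply, Ne.symm hk, fun h : a = k => hk h.symm] using this
    have hf' : ∀ k, d k ≠ 0 → ⁅f k, x⁆ = 0 := by
      intro k hk
      apply hf
      have := hd' k
      simp only [Finsupp.add_apply, Finsupp.single_apply]
      split_ifs <;> omega
    obtain ⟨y, hy, hy2⟩ := ih hd' hf'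
    have fa : ⁅f a, y⁆ = 0 := hy2 a da (hf a (by simpa [da] using hb))
    have hneg : wtv A a (c + d) < 0 := by
      apply wtv_neg A hA a i (hi a)
      · intro k
        have := hc k
        have := hd' k
        simp only [Finsupp.add_apply]; omega
      · have := hd' i
        simp only [Finsupp.add_apply]; omega
    obtain ⟨h1, h2⟩ := good_step A e f h G hA hbr hE he ef _ y hy a hneg fa b.toNat
    refine ⟨((LieAlgebra.ad ℂ L (e a)) ^ b.toNat) y, ?_, ?_⟩
    · convert h1 using 1
      rw [Int.toNat_of_nonneg hba]; abel
    · intro l hl fl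
      have hla : l ≠ a := by
        rintro rfl
        simp [da] at hl; exact hb hl
      apply h2 l hla
      apply hy2 l _ fl
      simpa [Finsupp.single_apply, Ne.symm hla] using hl

/-- Existence of nonzero elements in the claimed root spaces. -/
lemma exists_root (A : I → I → ℝ) (e f h : I → L) (G : (I →₀ ℤ) → Submodule ℂ L)
    (hA : ∀ i j, A i j ≤ 0) (hsym : ∀ i j, A i j = A j i)
    (hbr : ∀ c c' x y, x ∈ G c → y ∈ G c' → ⁅x, y⁆ ∈ G (c + c'))
    (hE : ∀ i, e i ∈ G (Finsupp.single i 1)) (e0 : ∀ i, e i ≠ 0)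
    (he : ∀ i j, ⁅h i, e j⁆ = (A i j : ℂ) • e j)
    (ef : ∀ i j, ⁅e i, f j⁆ = if i = j then h i else 0)
    (c : I →₀ ℤ) (hc : ∀ k, 0 ≤ c k) (i : I) (hi : ∀ l, A l i ≠ 0) (hci : 0 < c i)
    (hne : ∀ t : ℤ, 2 ≤ t → c ≠ Finsupp.single i t) : G c ≠ ⊥ := by
  have good0 : ∀ k, IsGood A h G (Finsupp.single k 1) (e k) := fun k =>
    ⟨e0 k, hE k, fun l => by rw [he, wtv_single]; simp⟩
  have fe : ∀ l k, l ≠ k → ⁅f l, e k⁆ = 0 := by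
    intro l k hlk
    rw [← lie_skew, ef, if_neg (Ne.symm hlk), neg_zero]
  suffices ∃ y, IsGood A h G c y by
    obtain ⟨y, hy⟩ := this
    intro hb
    have := hy.2.1
    rw [hb] at this
    exact hy.1 (by simpa using this)
  by_cases h1 : c i = 1
  · obtain ⟨y, hy, -⟩ := good_extend A e f h G hA hbr hE he ef _ _ (good0 i)
      (fun k => by simp only [Finsupp.single_apply]; split_ifs <;> omega) i hi (by simp)
      (c - Finsupp.single i 1) (by
      intro k
      have := hc k
      simp only [Finsupp.sub_apply, Finsupp.single_apply]
      split_ifs with hik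
      · subst hik; omega
      · omega) (by
      intro k hk
      apply fe
      rintro rfl
      simp [h1] at hk)
    exact ⟨y, by simpa using hy⟩
  · have h2 : 2 ≤ c i := by omega
    obtain ⟨k, hki, hk⟩ : ∃ k, k ≠ i ∧ 0 < c k := by
      by_contra! hcon
      apply hne (c i) h2
      ext l
      simp only [Finsupp.single_apply]
      split_ifs with hl
      · rw [hl]
      · have := hcon l (Ne.symm hl)
        have := hc l
        omega
    have hneg : wtv A i (Finsupp.single k 1) < 0 := by
      rw [wtv_single]
      have := lt_of_le_of_ne (hA i k) (by rw [hsym]; exact hi k)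
      simpa using this
    obtain ⟨g1, g2⟩ := good_step A e f h G hA hbr hE he ef _ _ (good0 k) i hneg
      (fe i k (Ne.symm hki)) (c i).toNat
    have g3 : ⁅f k, ((LieAlgebra.ad ℂ L (e i)) ^ (c i).toNat) (e k)⁆ = 0 := by
      obtain ⟨n, hn⟩ : ∃ n : ℕ, (c i).toNat = n + 2 := ⟨(c i).toNat - 2, by omega⟩
      rw [hn]
      clear hn g1 g2
      have fki : ⁅f k, e i⁆ = 0 := fe k i hki
      induction n with
      | zero =>
        rw [zero_add, pow_two, Module.End.mul_apply, LieAlgebra.ad_apply, LieAlgebra.ad_apply,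
          leibniz_lie, leibniz_lie (f k), fki, ← lie_skew (f k) (e k), ef]
        simp only [zero_lie, zero_add, if_true, lie_neg]
        rw [← lie_skew (e i) (h k), he]
        rw [lie_neg, lie_smul, lie_self, smul_zero, neg_zero, neg_zero]
      | succ n ih =>
        rw [show n + 1 + 2 = (n + 2) + 1 by ring, pow_succ', Module.End.mul_apply,
          LieAlgebra.ad_apply, leibniz_lie, fki, ih]
        simp
    rw [Int.toNat_of_nonneg (hc i)] at g1
    obtain ⟨y, hy, -⟩ := good_extend A e f h G hA hbr hE he ef _ _ g1
      (fun l => by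
        have := hc i
        simp only [Finsupp.add_apply, Finsupp.single_apply]; split_ifs <;> omega) i hi
      (by simp [Finsupp.single_apply, hki, hci])
      (c - (Finsupp.single k 1 + Finsupp.single i (c i))) (by
      intro l
      have := hc l
      simp only [Finsupp.sub_apply, Finsupp.add_apply, Finsupp.single_apply]
      split_ifs with ha hb hb
      · exact absurd (ha.trans hb.symm) hki
      · subst ha; omega
      · subst hb; omega
      · omega) (by
      intro l hl
      by_cases hlk : l = k
      · rw [hlk]; exact g3
      · apply g2 l _ (fe l k hlk)
        rintro rfl
        simp [Finsupp.single_apply, hki] at hl)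
    exact ⟨y, by simpa using hy⟩

/-- Only the claimed degrees can occur. -/
lemma root_restrict (A : I → I → ℂ) (e f h : I → L) (G : (I →₀ ℤ) → Submodule ℂ L)
    (gen : ∀ S : LieSubalgebra ℂ L, (∀ i, e i ∈ S) → (∀ i, f i ∈ S) → (∀ i, h i ∈ S) → S = ⊤)
    (hh : ∀ i j, ⁅h i, h j⁆ = 0) (he : ∀ i j, ⁅h i, e j⁆ = A i j • e j)
    (hf : ∀ i j, ⁅h i, f j⁆ = (-A i j) • f j)
    (ef : ∀ i j, ⁅e i, f j⁆ = if i = j then h i else 0)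
    (hint : iSupIndep G)
    (hbr : ∀ c c' x y, x ∈ G c → y ∈ G c' → ⁅x, y⁆ ∈ G (c + c'))
    (hE : ∀ i, e i ∈ G (Finsupp.single i 1))
    (hF : ∀ i, f i ∈ G (-Finsupp.single i 1))
    (hH : ∀ i, h i ∈ G 0)
    (c : I →₀ ℤ) (c0 : c ≠ 0) (hc : ∀ k, 0 ≤ c k) (hG : G c ≠ ⊥) :
    (∃ i, c = Finsupp.single i 1) ∨ ∃ a b, 0 < c a ∧ 0 < c b ∧ ⁅e a, e b⁆ ≠ 0 := by
  by_contra! hcon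
  obtain ⟨hc1, hc2⟩ := hcon
  apply hG
  have hd := hint c
  have htop : (⨆ d, ⨆ (_ : d ≠ c), G d) = ⊤ := by
    rw [eq_top_iff, ← span_top_s5 A e f h gen hh he hf ef, Submodule.span_le]
    have hsub : ∀ d x, d ≠ c → x ∈ G d → x ∈ (⨆ d, ⨆ (_ : d ≠ c), G d) := fun d x hd hx =>
      (le_iSup₂_of_le (f := fun d (_ : d ≠ c) => G d) d hd le_rfl) hx
    rintro x ((⟨i, w, rfl⟩ | ⟨i, w, rfl⟩) | ⟨i, rfl⟩)
    · have hm := rnb_mem e G 1 hbr (by simpa using hE) i w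
      rw [one_smul] at hm
      by_cases hw : wtw (i :: w) = c
      · cases w with
        | nil => exact absurd (by simpa [wtw] using hw.symm) (hc1 i)
        | cons j w =>
          rw [rnb_zero e i j w ?_]
          · exact zero_mem _
          · intro a ha b hb
            exact hc2 a b (hw ▸ wtw_pos _ _ ha) (hw ▸ wtw_pos _ _ hb)
      · exact hsub _ _ hw hm
    · have hm := rnb_mem f G (-1) hbr (by simpa using hF) i w
      refine hsub _ _ ?_ hm
      intro heq
      have h1 := hc i
      rw [← heq] at h1
      have h2 := wtw_pos (i :: w) i (by simp)
      simp at h1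
      omega
    · exact hsub _ _ (Ne.symm c0) (hH i)
  rw [htop] at hd
  exact disjoint_top.1 hd

end AbstractPart

section Model

variable {I : Type*}

/-- Commutation relations for the letters in `J`. -/
def comRel (J : Set I) (x y : FreeAlgebra ℂ I) : Prop :=
  ∃ j ∈ J, ∃ k ∈ J, x = FreeAlgebra.ι ℂ j * FreeAlgebra.ι ℂ k ∧
    y = FreeAlgebra.ι ℂ k * FreeAlgebra.ι ℂ j

/-- The enveloping algebra of the positive part. -/
def UPos (J : Set I) := RingQuot (comRel J)

noncomputable instance (J : Set I) : Ring (UPos J) := inferInstanceAs (Ring (RingQuot (comRel J)))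

noncomputable instance (J : Set I) : Algebra ℂ (UPos J) :=
  inferInstanceAs (Algebra ℂ (RingQuot (comRel J)))

/-- The quotient map. -/
noncomputable def UMk (J : Set I) : FreeAlgebra ℂ I →ₐ[ℂ] UPos J :=
  RingQuot.mkAlgHom ℂ (comRel J)

/-- The generators. -/
noncomputable def UX (J : Set I) (i : I) : UPos J :=
  UMk J (FreeAlgebra.ι ℂ i)

lemma UX_comm (J : Set I) (j k : I) (hj : j ∈ J) (hk : k ∈ J) :
    UX J j * UX J k = UX J k * UX J j := by
  have : comRel J (FreeAlgebra.ι ℂ j * FreeAlgebra.ι ℂ k) (FreeAlgebra.ι ℂ k * FreeAlgebra.ι ℂ j) :=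
    ⟨j, hj, k, hk, rfl, rfl⟩
  have : UMk J _ = UMk J _ := RingQuot.mkAlgHom_rel ℂ this
  simpa [UX] using this

/-- Lifting. -/
lemma U_lift {B : Type*} [Ring B] [Algebra ℂ B] (J : Set I) (g : I → B)
    (hg : ∀ j ∈ J, ∀ k ∈ J, g j * g k = g k * g j) :
    ∃ φ : UPos J →ₐ[ℂ] B, ∀ i, φ (UX J i) = g i := by
  have key : ∀ ⦃x y⦄, comRel J x y → FreeAlgebra.lift ℂ g x = FreeAlgebra.lift ℂ g y := ?_
  · refine ⟨(RingQuot.liftAlgHom ℂ ⟨FreeAlgebra.lift ℂ g, key⟩ : RingQuot (comRel J) →ₐ[ℂ] B), ?_⟩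
    intro i
    exact (RingQuot.liftAlgHom_mkAlgHom_apply ℂ (FreeAlgebra.lift ℂ g) key _).trans (by simp)
  · rintro x y ⟨j, hj, k, hk, rfl, rfl⟩
    simpa using hg j hj k hk

lemma U_ind (J : Set I) (S : Submodule ℂ (UPos J)) (h1 : 1 ∈ S)
    (hX : ∀ i, ∀ u ∈ S, UX J i * u ∈ S) (u : UPos J) : u ∈ S := by
  obtain ⟨v, rfl⟩ : ∃ v, UMk J v = u := RingQuot.mkAlgHom_surjective ℂ (comRel J) u
  suffices ∀ w ∈ S, UMk J v * w ∈ S by simpa using this 1 h1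
  induction v using FreeAlgebra.induction with
  | grade0 r =>
    intro w hw
    rw [AlgHom.commutes, ← Algebra.smul_def]
    exact S.smul_mem _ hw
  | grade1 i => exact hX i
  | mul a b ha hb =>
    intro w hw
    rw [map_mul, mul_assoc]
    exact ha _ (hb _ hw)
  | add a b ha hb =>
    intro w hw
    rw [map_add, add_mul]
    exact add_mem (ha _ hw) (hb _ hw)

lemma U_zero (J : Set I) (G : UPos J →ₗ[ℂ] UPos J) (h1 : G 1 = 0)
    (hX : ∀ i u, G (UX J i * u) = UX J i * G u) : G = 0 := by
  ext u
  have := U_ind J (LinearMap.ker G) (by simpa using h1)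
    (fun i u hu => by
      rw [LinearMap.mem_ker] at hu ⊢
      rw [hX, hu, mul_zero]) u
  simpa using this

/-- Recursively defined operators. -/
lemma U_op (J : Set I) (D : I → UPos J →ₗ[ℂ] UPos J)
    (hD : ∀ j ∈ J, ∀ k ∈ J, ∀ v, UX J j * D k v + D j (UX J k * v)
      = UX J k * D j v + D k (UX J j * v)) :
    ∃ F : UPos J →ₗ[ℂ] UPos J, F 1 = 0 ∧ ∀ j u, F (UX J j * u) = UX J j * F u + D j u := by
  let g : I → Module.End ℂ (UPos J × UPos J) := fun j =>
    LinearMap.prod ((LinearMap.mulLeft ℂ (UX J j)).comp (LinearMap.fst ℂ _ _))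
      ((LinearMap.mulLeft ℂ (UX J j)).comp (LinearMap.snd ℂ _ _)
        + (D j).comp (LinearMap.fst ℂ _ _))
  have hg : ∀ j p, g j p = (UX J j * p.1, UX J j * p.2 + D j p.1) := fun j p => rfl
  obtain ⟨φ, hφ⟩ := U_lift J g (by
    intro j hj k hk
    refine LinearMap.ext fun p => ?_
    rw [Module.End.mul_apply, Module.End.mul_apply, hg, hg, hg, hg]
    refine Prod.ext ?_ ?_
    · simp only [← mul_assoc, UX_comm J j k hj hk]
    · simp only [mul_add, ← mul_assoc, UX_comm J j k hj hk, add_assoc, hD j hj k hk])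
  have hfst : ∀ u, (φ u (1, 0)).1 = u := by
    intro u
    have := U_zero J ((LinearMap.fst ℂ _ _).comp
      ((LinearMap.applyₗ ((1, 0) : UPos J × UPos J)).comp φ.toLinearMap) - LinearMap.id)
      (by simp) (by intro i u; simp [hφ, hg, mul_sub])
    have := LinearMap.congr_fun this u
    simpa [sub_eq_zero] using this
  refine ⟨(LinearMap.snd ℂ _ _).comp
      ((LinearMap.applyₗ ((1, 0) : UPos J × UPos J)).comp φ.toLinearMap), by simp, ?_⟩
  intro j u
  simp [hφ, hg, hfst]

end Model

section Concrete

variable {I : Type*}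

section Rep

attribute [local instance] LieRing.ofAssociativeRing

lemma end_bracket {M : Type*} [AddCommGroup M] [Module ℂ M] (f g : Module.End ℂ M) (u : M) :
    (⁅f, g⁆ : Module.End ℂ M) u = f (g u) - g (f u) := rfl

lemma borcherds_e_ne (A : I → I → ℝ) (J : Set I)
    (hsym : ∀ i j, A i j = A j i) (hdiag : ∀ i, A i i ≤ 0)
    (hzero : ∀ i j, A i j = 0 ↔ i ∈ J ∧ j ∈ J) (i : I) : gE A i ≠ 0 := by
  have exH : ∀ i, ∃ F : UPos J →ₗ[ℂ] UPos J, F 1 = 0 ∧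
      ∀ j u, F (UX J j * u) = UX J j * F u + (A i j : ℂ) • (UX J j * u) := by
    intro i
    refine U_op J (fun j => (A i j : ℂ) • LinearMap.mulLeft ℂ (UX J j)) ?_
    intro j hj k hk v
    simp only [LinearMap.smul_apply, LinearMap.mulLeft_apply, mul_smul_comm, ← mul_assoc,
      UX_comm J j k hj hk]
    abel
  choose H H1 HX using exH
  have exF : ∀ i, ∃ F : UPos J →ₗ[ℂ] UPos J, F 1 = 0 ∧
      ∀ j u, F (UX J j * u) = UX J j * F u + (if i = j then (-1 : ℂ) else 0) • H i u := by
    intro i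
    refine U_op J (fun j => (if i = j then (-1 : ℂ) else 0) • H i) ?_
    intro j hj k hk v
    simp only [LinearMap.smul_apply, HX, mul_smul_comm]
    by_cases h1 : i = j
    · subst h1
      have := (hzero i k).2 ⟨hj, hk⟩
      have h2 := (hzero i i).2 ⟨hj, hj⟩
      simp [this, h2]
      abel
    · by_cases h2 : i = k
      · subst h2
        have := (hzero i j).2 ⟨hk, hj⟩
        simp [this, h1]
      · simp [h1, h2]
  choose F F1 FX using exF
  let X : I → Module.End ℂ (UPos J) := fun i => LinearMap.mulLeft ℂ (UX J i)
  let ρ : FreeLieAlgebra ℂ (BGen I) →ₗ⁅ℂ⁆ Module.End ℂ (UPos J) :=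
    FreeLieAlgebra.lift ℂ (fun g => match g with
      | BGen.E i => X i
      | BGen.F i => F i
      | BGen.H i => H i)
  have ρE : ∀ i, ρ (of ℂ (BGen.E i)) = X i := fun i => by simp [ρ]
  have ρF : ∀ i, ρ (of ℂ (BGen.F i)) = F i := fun i => by simp [ρ]
  have ρH : ∀ i, ρ (of ℂ (BGen.H i)) = H i := fun i => by simp [ρ]
  have hHH : ∀ i j, ⁅(H i : Module.End ℂ (UPos J)), H j⁆ = 0 := by
    intro i j
    apply U_zero
    · simp [end_bracket, H1]
    · intro k u
      simp only [end_bracket, HX, map_add, map_smul, mul_sub]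
      simp only [smul_add, smul_smul, mul_comm (A i k : ℂ)]
      abel
  have hHF : ∀ i j, ⁅(H i : Module.End ℂ (UPos J)), F j⁆ + (A i j : ℂ) • F j = 0 := by
    intro i j
    apply U_zero
    · simp [end_bracket, H1, F1]
    · intro k u
      have hc := LinearMap.congr_fun (hHH i j) u
      simp only [end_bracket, LinearMap.zero_apply, sub_eq_zero] at hc
      simp only [end_bracket, LinearMap.add_apply, LinearMap.smul_apply, HX, FX, map_add,
        map_smul, mul_sub, mul_add, mul_smul_comm, hc]
      by_cases hjk : j = k
      · subst hjk
        simp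
        abel
      · simp [hjk]
  have hle : borcherdsIdeal A ≤ ρ.ker := by
    unfold borcherdsIdeal
    rw [LieSubmodule.lieSpan_le]
    rintro x ⟨i, j, hx⟩
    rw [SetLike.mem_coe, LieHom.mem_ker]
    rcases hx with rfl | rfl | rfl | rfl | ⟨n, _, hpos, _⟩ | ⟨hij, rfl | rfl⟩
    · rw [LieHom.map_lie, ρH, ρH, hHH]
    · rw [map_sub, map_smul, LieHom.map_lie, ρH, ρE]
      refine LinearMap.ext fun u => ?_
      simp [end_bracket, X, HX]
    · rw [map_add, map_smul, LieHom.map_lie, ρH, ρF, hHF]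
    · rw [map_sub, LieHom.map_lie, ρE, ρF]
      refine LinearMap.ext fun u => ?_
      by_cases h : i = j
      · subst h
        simp [end_bracket, X, FX, ρH]
      · simp [end_bracket, X, FX, h, Ne.symm h]
    · exact absurd hpos (not_lt.2 (hdiag i))
    · rw [LieHom.map_lie, ρE, ρE]
      obtain ⟨hi, hj⟩ := (hzero i j).1 hij
      refine LinearMap.ext fun u => ?_
      simp only [end_bracket, X, LinearMap.mulLeft_apply, ← mul_assoc,
        UX_comm J i j hi hj, sub_self, LinearMap.zero_apply]
    · rw [LieHom.map_lie, ρF, ρF]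
      apply U_zero
      · simp [end_bracket, F1]
      · intro k u
        have hc := LinearMap.congr_fun (hHF i j) u
        have hc' := LinearMap.congr_fun (hHF j i) u
        simp only [end_bracket, LinearMap.add_apply, LinearMap.smul_apply,
          hij, hsym j i, Complex.ofReal_zero, zero_smul, add_zero,
          LinearMap.zero_apply, sub_eq_zero] at hc hc'
        simp only [end_bracket, FX, map_add, map_smul, mul_sub, hc, hc']
        abel
  intro h0
  have hmem : of ℂ (BGen.E i) ∈ borcherdsIdeal A := by
    have : (LieSubmodule.Quotient.mk' (borcherdsIdeal A)) (of ℂ (BGen.E i)) = 0 := h0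
    exact (LieSubmodule.Quotient.mk_eq_zero _).1 this
  have hk := hle hmem
  rw [LieHom.mem_ker, ρE] at hk
  have h1 : UX J i = 0 := by
    have := LinearMap.congr_fun hk 1
    simpa [X] using this
  obtain ⟨φ, hφ⟩ := U_lift J (fun _ => (1 : ℂ)) (by simp)
  have := hφ i
  rw [h1, map_zero] at this
  exact zero_ne_one this

end Rep

lemma borcherds_gen (A : I → I → ℝ) (S : LieSubalgebra ℂ (BorcherdsAlgebra A))
    (h1 : ∀ i, gE A i ∈ S) (h2 : ∀ i, gF A i ∈ S) (h3 : ∀ i, gH A i ∈ S) : S = ⊤ := by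
  let π : FreeLieAlgebra ℂ (BGen I) →ₗ⁅ℂ⁆ BorcherdsAlgebra A :=
    { (LieSubmodule.Quotient.mk' (borcherdsIdeal A) :
        FreeLieAlgebra ℂ (BGen I) →ₗ[ℂ] BorcherdsAlgebra A) with
      map_lie' := fun {x y} => LieSubmodule.Quotient.mk_bracket _ x y }
  let g : BGen I → S.comap π := fun g => ⟨of ℂ g, by
    cases g with
    | E i => exact h1 i
    | F i => exact h2 i
    | H i => exact h3 i⟩
  have hid : (S.comap π).incl.comp (FreeLieAlgebra.lift ℂ g) = LieHom.id := by
    apply FreeLieAlgebra.hom_ext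
    intro x
    simp [g]
  rw [eq_top_iff]
  intro x _
  obtain ⟨y, rfl⟩ := LieSubmodule.Quotient.surjective_mk' (borcherdsIdeal A) x
  have := (FreeLieAlgebra.lift ℂ g y).2
  have hy : ((FreeLieAlgebra.lift ℂ g y : S.comap π) : FreeLieAlgebra ℂ (BGen I)) = y :=
    LieHom.congr_fun hid y
  rw [hy] at this
  exact this

lemma borcherds_rel (A : I → I → ℝ) (x : FreeLieAlgebra ℂ (BGen I)) (hx : x ∈ borcherdsRels A) :
    LieSubmodule.Quotient.mk' (borcherdsIdeal A) x = 0 :=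
  (LieSubmodule.Quotient.mk_eq_zero _).2 (LieSubmodule.subset_lieSpan hx)

lemma b_br (A : I → I → ℝ) (x y : FreeLieAlgebra ℂ (BGen I)) :
    LieSubmodule.Quotient.mk' (borcherdsIdeal A) ⁅x, y⁆ =
      (⁅(LieSubmodule.Quotient.mk' (borcherdsIdeal A) x : BorcherdsAlgebra A),
        (LieSubmodule.Quotient.mk' (borcherdsIdeal A) y : BorcherdsAlgebra A)⁆ :
          BorcherdsAlgebra A) :=
  LieSubmodule.Quotient.mk_bracket _ x y

lemma b_hh (A : I → I → ℝ) (i j : I) : ⁅gH A i, gH A j⁆ = 0 := by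
  have := borcherds_rel A _ ⟨i, j, Or.inl rfl⟩
  rwa [b_br] at this

lemma b_he (A : I → I → ℝ) (i j : I) : ⁅gH A i, gE A j⁆ = (A i j : ℂ) • gE A j := by
  have := borcherds_rel A _ ⟨i, j, Or.inr (Or.inl rfl)⟩
  rw [map_sub, map_smul, b_br, sub_eq_zero] at this
  exact this

lemma b_hf (A : I → I → ℝ) (i j : I) : ⁅gH A i, gF A j⁆ = (-(A i j : ℂ)) • gF A j := by
  have := borcherds_rel A _ ⟨i, j, Or.inr (Or.inr (Or.inl rfl))⟩
  rw [map_add, map_smul, b_br] at this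
  rw [neg_smul]
  exact eq_neg_of_add_eq_zero_left this

lemma b_ef (A : I → I → ℝ) (i j : I) : ⁅gE A i, gF A j⁆ = if i = j then gH A i else 0 := by
  have := borcherds_rel A _ ⟨i, j, Or.inr (Or.inr (Or.inr (Or.inl rfl)))⟩
  rw [map_sub, b_br, sub_eq_zero] at this
  refine Eq.trans this ?_
  split_ifs
  · rfl
  · simp

lemma b_ee (A : I → I → ℝ) (i j : I) (h : A i j = 0) : ⁅gE A i, gE A j⁆ = 0 := by
  have := borcherds_rel A _ ⟨i, j, Or.inr (Or.inr (Or.inr (Or.inr (Or.inr ⟨h, Or.inl rfl⟩))))⟩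
  rwa [b_br] at this

end Concrete

/-- The set of positive roots of a Borcherds algebra with all diagonal entries
`≤ 0` and zero block exactly on `J`: identifying a root `φ = Σ cᵢ αᵢ` (the simple
roots being linearly independent over the extended Cartan subalgebra) with its
coordinate vector `c : I →₀ ℤ`, and the root space of `φ` with the component
`𝔊 c` of the canonical `ℤ^I`-gradation, the positive roots are exactly
`{α_j : j ∈ J} ∪ ({Σ α_{j_k} + Σ α_{i_k} : j_k ∈ J, i_k ∉ J, p > 0} ∖ {tα_i : t ≥ 2, i ∉ J})`. -/
theorem borcherds_positive_roots {I : Type*} (A : I → I → ℝ)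
    (hsym : ∀ i j, A i j = A j i)
    (hoff : ∀ i j, i ≠ j → A i j ≤ 0)
    (hdiag : ∀ i, A i i ≤ 0)
    (J : Set I) (hJ : J = {j | A j j = 0})
    (hzero : ∀ i j, A i j = 0 ↔ i ∈ J ∧ j ∈ J)
    (𝔊 : (I →₀ ℤ) → Submodule ℂ (BorcherdsAlgebra A))
    (hint : DirectSum.IsInternal 𝔊)
    (hbr : ∀ c c' x y, x ∈ 𝔊 c → y ∈ 𝔊 c' → ⁅x, y⁆ ∈ 𝔊 (c + c'))
    (hE : ∀ i, gE A i ∈ 𝔊 (Finsupp.single i 1))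
    (hF : ∀ i, gF A i ∈ 𝔊 (-Finsupp.single i 1))
    (hH : ∀ i, gH A i ∈ 𝔊 0) :
    {c : I →₀ ℤ | c ≠ 0 ∧ (∀ i, 0 ≤ c i) ∧ 𝔊 c ≠ ⊥}
      = {c | ∃ j ∈ J, c = Finsupp.single j 1} ∪
        ({c | (∀ i, 0 ≤ c i) ∧ ∃ i ∉ J, 0 < c i} \
          {c | ∃ t : ℤ, 2 ≤ t ∧ ∃ i ∉ J, c = Finsupp.single i t}) := by
  have hA : ∀ i j, A i j ≤ 0 := by
    intro i j
    by_cases h : i = j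
    · subst h; exact hdiag i
    · exact hoff i j h
  have e0 := borcherds_e_ne A J hsym hdiag hzero
  ext c
  simp only [Set.mem_ofPred_eq, Set.mem_union, Set.mem_sdiff]
  constructor
  · rintro ⟨c0, hc, hG⟩
    rcases root_restrict (fun i j => (A i j : ℂ)) (gE A) (gF A) (gH A) 𝔊 (borcherds_gen A)
      (b_hh A) (b_he A) (b_hf A) (b_ef A) hint.submodule_iSupIndep hbr hE hF hH c c0 hc hG with
      ⟨i, rfl⟩ | ⟨a, b, ha, hb, hab⟩
    · by_cases hi : i ∈ J
      · exact Or.inl ⟨i, hi, rfl⟩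
      · refine Or.inr ⟨⟨hc, i, hi, by simp⟩, ?_⟩
        rintro ⟨t, ht, k, hk, heq⟩
        have := DFunLike.congr_fun heq k
        simp only [Finsupp.single_apply] at this
        split_ifs at this <;> omega
    · refine Or.inr ⟨⟨hc, ?_⟩, ?_⟩
      · by_contra! hcon
        apply hab
        apply b_ee
        rw [hzero]
        constructor
        · by_contra h
          have := hcon a h
          omega
        · by_contra h
          have := hcon b h
          omega
      · rintro ⟨t, ht, k, hk, rfl⟩
        apply hab
        simp only [Finsupp.single_apply] at ha hb
        split_ifs at ha hb
        · subst_vars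
          exact lie_self _
        all_goals omega
  · rintro (⟨j, hj, rfl⟩ | ⟨⟨hc, i, hi, hci⟩, hn⟩)
    · refine ⟨by simp, fun k => ?_, ?_⟩
      · simp only [Finsupp.single_apply]
        split_ifs <;> omega
      · intro hb
        have := hE j
        rw [hb] at this
        exact e0 j (by simpa using this)
    · refine ⟨?_, hc, ?_⟩
      · rintro rfl
        simp at hci
      · refine exists_root A (gE A) (gF A) (gH A) 𝔊 hA hsym hbr hE e0 (b_he A) (b_ef A) c hc i
          ?_ hci ?_
        · intro l hl
          exact hi ((hzero l i).1 hl).2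
        · intro t ht heq
          exact hn ⟨t, ht, i, hi, heq⟩
end
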